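/- arXiv:2403.11994 — 3 statements merged into one kernel-verified Lean document; each statement's English description precedes it below -/
import Mathlib

section
/- Let f: ℝ^ℓ → [0, +∞) be a log-concave function with 0 < ∫_{ℝ^ℓ} f < ∞ and ∫_{ℝ^ℓ} x f(x) dx = 0. Then for every unit vector θ in ℝ^ℓ, ∫_0^∞ f(tθ) dt ≥ e^{−ℓ} · ∫_{−∞}^∞ f(tθ) dt. -/
open MeasureTheory Real Set

/-- A nonnegative function is log-concave (i.e. of the form `e^{-V}` with
`V : ℝ^ℓ → (-∞, +∞]` convex) iff it satisfies the multiplicative concavity inequality. -/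
def LogConcaveFun {E : Type*} [AddCommGroup E] [Module ℝ E] (f : E → ℝ) : Prop :=
  ∀ x y : E, ∀ t : ℝ, 0 ≤ t → t ≤ 1 →
    f x ^ t * f y ^ (1 - t) ≤ f (t • x + (1 - t) • y)

open scoped ENNReal

theorem volume_add_le_of_isCompact {K L C : Set ℝ} (hK : IsCompact K) (hL : IsCompact L)
    (hKn : K.Nonempty) (hLn : L.Nonempty) (h : ∀ a ∈ K, ∀ b ∈ L, a + b ∈ C) :
    volume K + volume L ≤ volume C := by
  obtain ⟨M, hM, hMK⟩ := hK.exists_isGreatest hKn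
  obtain ⟨m, hm, hmL⟩ := hL.exists_isLeast hLn
  have h1 : volume ((fun x => x + -m) ⁻¹' K) = volume K := measure_preimage_add_right _ _ _
  have h2 : volume ((fun x => x + -M) ⁻¹' L) = volume L := measure_preimage_add_right _ _ _
  rw [← h1, ← h2, ← measure_union₀]
  · apply measure_mono
    rintro x (hx | hx)
    · simpa using h _ hx _ hm
    · simpa using h _ hM _ hx
  · exact (hL.measurableSet.preimage (by fun_prop)).nullMeasurableSet
  · refine measure_mono_null (t := {M + m}) ?_ (by simp)
    rintro x ⟨hx, hx'⟩
    have := hMK hx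
    have := hmL hx'
    simp only [mem_singleton_iff]
    linarith

/-- One-dimensional Brunn–Minkowski inequality. -/
theorem volume_add_le_of_add_mem {A B C : Set ℝ} (hA : MeasurableSet A) (hB : MeasurableSet B)
    (hAn : A.Nonempty) (hBn : B.Nonempty) (h : ∀ a ∈ A, ∀ b ∈ B, a + b ∈ C) :
    volume A + volume B ≤ volume C := by
  obtain ⟨a, ha⟩ := hAn
  obtain ⟨b, hb⟩ := hBn
  have inner : ∀ S : Set ℝ, MeasurableSet S →
      volume S = ⨆ (K : Set ℝ) (_ : K ⊆ S ∧ IsCompact K), volume K := fun S hS => by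
    simp_rw [hS.measure_eq_iSup_isCompact, iSup_and]
  rw [inner A hA, inner B hB]
  refine ENNReal.biSup_add_biSup_le' ⟨∅, by simp⟩ ⟨∅, by simp⟩ fun K hK L hL => ?_
  refine (add_le_add (measure_mono (subset_insert a K)) (measure_mono (subset_insert b L))).trans ?_
  refine volume_add_le_of_isCompact (hK.2.insert a) (hL.2.insert b) (insert_nonempty _ _)
    (insert_nonempty _ _) fun x hx y hy => h x ?_ y ?_
  · exact insert_subset ha hK.1 hx
  · exact insert_subset hb hL.1 hy

theorem lintegral_eq_lintegral_Ioo_meas_lt {A : ℝ → ℝ} (hA : Measurable A) (hA0 : ∀ x, 0 ≤ A x)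
    (hA1 : ∀ x, A x ≤ 1) :
    ∫⁻ x, ENNReal.ofReal (A x) = ∫⁻ t in Ioo (0 : ℝ) 1, volume {x | t < A x} := by
  rw [lintegral_eq_lintegral_meas_lt volume (Filter.Eventually.of_forall hA0) hA.aemeasurable]
  have : Ioi (0 : ℝ) = Ioo 0 1 ∪ Ici 1 := (Ioo_union_Ici_eq_Ioi one_pos).symm
  rw [this, lintegral_union measurableSet_Ici]
  · rw [setLIntegral_congr_fun (g := fun _ => 0) measurableSet_Ici]
    · simp
    · intro t ht
      have : {x | t < A x} = ∅ := by
        ext x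
        simpa using (hA1 x).trans ht
      simp [this]
  · exact Set.disjoint_left.2 fun x hx hx' => absurd hx.2 (not_lt.2 hx')

theorem prekopaLeindler_of_sup_eq_one {A B h : ℝ → ℝ} (hA : Measurable A) (hB : Measurable B)
    (hh : Measurable h) (hA0 : ∀ x, 0 ≤ A x) (hB0 : ∀ x, 0 ≤ B x) (hh0 : ∀ x, 0 ≤ h x)
    (hA1 : ∀ x, A x ≤ 1) (hB1 : ∀ x, B x ≤ 1) (hAs : ∀ u < 1, ∃ x, u < A x)
    (hBs : ∀ u < 1, ∃ x, u < B x) {s : ℝ} (hs0 : 0 < s) (hs1 : s < 1)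
    (H : ∀ x y, A x ^ s * B y ^ (1 - s) ≤ h (s * x + (1 - s) * y)) :
    ENNReal.ofReal s * (∫⁻ x, ENNReal.ofReal (A x)) +
      ENNReal.ofReal (1 - s) * (∫⁻ x, ENNReal.ofReal (B x)) ≤ ∫⁻ x, ENNReal.ofReal (h x) := by
  have hs1' : 0 < 1 - s := by linarith
  have anti : ∀ f : ℝ → ℝ, Measurable fun t => volume {x | t < f x} := fun f =>
    Antitone.measurable fun t t' htt => measure_mono fun x hx => htt.trans_lt hx
  rw [lintegral_eq_lintegral_Ioo_meas_lt hA hA0 hA1, lintegral_eq_lintegral_Ioo_meas_lt hB hB0 hB1,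
    lintegral_eq_lintegral_meas_lt volume (Filter.Eventually.of_forall hh0) hh.aemeasurable,
    ← lintegral_const_mul _ (anti A), ← lintegral_const_mul _ (anti B),
    ← lintegral_add_left ((anti A).const_mul _)]
  refine le_trans ?_ (lintegral_mono_set (show Ioo (0 : ℝ) 1 ⊆ Ioi 0 from Ioo_subset_Ioi_self))
  refine setLIntegral_mono (anti h) fun t ht => ?_
  have scale : ∀ f : ℝ → ℝ, ∀ r : ℝ, 0 < r → ENNReal.ofReal r * volume {x | t < f x} =
      volume ((fun x => r⁻¹ * x) ⁻¹' {x | t < f x}) := by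
    intro f r hr
    rw [Real.volume_preimage_mul_left (by positivity), inv_inv, abs_of_pos hr]
  rw [scale A s hs0, scale B (1 - s) hs1']
  apply volume_add_le_of_add_mem
  · exact (measurableSet_lt measurable_const hA).preimage (by fun_prop)
  · exact (measurableSet_lt measurable_const hB).preimage (by fun_prop)
  · obtain ⟨x, hx⟩ := hAs t ht.2
    exact ⟨s * x, by simpa [hs0.ne'] using hx⟩
  · obtain ⟨x, hx⟩ := hBs t ht.2
    exact ⟨(1 - s) * x, by simpa [hs1'.ne'] using hx⟩
  · intro a ha b hb
    have h1 := H (s⁻¹ * a) ((1 - s)⁻¹ * b)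
    rw [mul_inv_cancel_left₀ hs0.ne', mul_inv_cancel_left₀ hs1'.ne'] at h1
    refine lt_of_lt_of_le ?_ h1
    simp only [mem_preimage, mem_ofPred_eq] at ha hb
    calc t = t ^ s * t ^ (1 - s) := by rw [← Real.rpow_add ht.1]; simp
      _ < _ := mul_lt_mul'' (Real.rpow_lt_rpow ht.1.le ha hs0)
        (Real.rpow_lt_rpow ht.1.le hb hs1') (Real.rpow_nonneg ht.1.le _)
        (Real.rpow_nonneg ht.1.le _)

theorem ENNReal.rpow_mul_rpow_le_arith_mean (a b : ℝ≥0∞) {s : ℝ} (hs0 : 0 < s) (hs1 : s < 1) :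
    a ^ s * b ^ (1 - s) ≤ ENNReal.ofReal s * a + ENNReal.ofReal (1 - s) * b := by
  have hs1' : 0 < 1 - s := by linarith
  have hpq : (s⁻¹).HolderConjugate (1 - s)⁻¹ := by
    rw [Real.holderConjugate_iff]
    exact ⟨(one_lt_inv₀ hs0).2 hs1, by simp⟩
  refine (ENNReal.young_inequality _ _ hpq).trans (le_of_eq ?_)
  rw [← ENNReal.rpow_mul, ← ENNReal.rpow_mul, mul_inv_cancel₀ hs0.ne', mul_inv_cancel₀ hs1'.ne',
    ENNReal.ofReal_inv_of_pos hs0, ENNReal.ofReal_inv_of_pos hs1']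
  simp [div_eq_mul_inv, mul_comm]

/-- One-dimensional Prékopa–Leindler inequality for bounded functions. -/
theorem prekopaLeindler {A B h : ℝ → ℝ} (hA : Measurable A) (hB : Measurable B)
    (hh : Measurable h) (hA0 : ∀ x, 0 ≤ A x) (hB0 : ∀ x, 0 ≤ B x) (hh0 : ∀ x, 0 ≤ h x)
    (hAb : BddAbove (range A)) (hBb : BddAbove (range B)) {s : ℝ} (hs0 : 0 < s) (hs1 : s < 1)
    (H : ∀ x y, A x ^ s * B y ^ (1 - s) ≤ h (s * x + (1 - s) * y)) :
    (∫⁻ x, ENNReal.ofReal (A x)) ^ s * (∫⁻ x, ENNReal.ofReal (B x)) ^ (1 - s)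
      ≤ ∫⁻ x, ENNReal.ofReal (h x) := by
  have hs1' : 0 < 1 - s := by linarith
  set a := ⨆ x, A x
  set b := ⨆ x, B x
  have haA : ∀ x, A x ≤ a := le_ciSup hAb
  have hbB : ∀ x, B x ≤ b := le_ciSup hBb
  rcases ((hA0 0).trans (haA 0)).eq_or_lt with ha | ha
  · have : ∀ x, A x = 0 := fun x => le_antisymm ((haA x).trans ha.ge) (hA0 x)
    simp [this, hs0]
  rcases ((hB0 0).trans (hbB 0)).eq_or_lt with hb | hb
  · have : ∀ x, B x = 0 := fun x => le_antisymm ((hbB x).trans hb.ge) (hB0 x)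
    simp [this, hs1]
  set c := a ^ s * b ^ (1 - s)
  have hc : 0 < c := by positivity
  have key := prekopaLeindler_of_sup_eq_one (A := fun x => a⁻¹ * A x) (B := fun x => b⁻¹ * B x)
    (h := fun x => c⁻¹ * h x) (hA.const_mul _) (hB.const_mul _) (hh.const_mul _)
    (fun x => mul_nonneg (by positivity) (hA0 x)) (fun x => mul_nonneg (by positivity) (hB0 x))
    (fun x => mul_nonneg (by positivity) (hh0 x))
    (fun x => by rw [inv_mul_le_iff₀ ha, mul_one]; exact haA x)
    (fun x => by rw [inv_mul_le_iff₀ hb, mul_one]; exact hbB x)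
    (fun u hu => by
      obtain ⟨x, hx⟩ := exists_lt_of_lt_ciSup (show a * u < a by nlinarith)
      exact ⟨x, by rwa [lt_inv_mul_iff₀ ha]⟩)
    (fun u hu => by
      obtain ⟨x, hx⟩ := exists_lt_of_lt_ciSup (show b * u < b by nlinarith)
      exact ⟨x, by rwa [lt_inv_mul_iff₀ hb]⟩) hs0 hs1
    (fun x y => by
      rw [Real.mul_rpow (by positivity) (hA0 x), Real.mul_rpow (by positivity) (hB0 y),
        Real.inv_rpow ha.le, Real.inv_rpow hb.le, mul_mul_mul_comm, ← mul_inv]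
      exact mul_le_mul_of_nonneg_left (H x y) (by positivity))
  have hi : ∀ r : ℝ, 0 < r → ∀ f : ℝ → ℝ, ∫⁻ x, ENNReal.ofReal (r⁻¹ * f x) =
      (ENNReal.ofReal r)⁻¹ * ∫⁻ x, ENNReal.ofReal (f x) := by
    intro r hr f
    simp_rw [ENNReal.ofReal_mul (inv_nonneg.2 hr.le), ENNReal.ofReal_inv_of_pos hr]
    exact lintegral_const_mul' _ _ (by simpa using hr)
  rw [hi a ha, hi b hb, hi c hc] at key
  have key' := (ENNReal.rpow_mul_rpow_le_arith_mean _ _ hs0 hs1).trans key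
  rw [ENNReal.mul_rpow_of_nonneg _ _ hs0.le, ENNReal.mul_rpow_of_nonneg _ _ hs1'.le,
    ENNReal.inv_rpow, ENNReal.inv_rpow, ENNReal.ofReal_rpow_of_pos ha,
    ENNReal.ofReal_rpow_of_pos hb, mul_mul_mul_comm, ← ENNReal.mul_inv (by simp) (by simp),
    ← ENNReal.ofReal_mul (by positivity)] at key'
  exact (ENNReal.mul_le_mul_iff_right (by simp) (by simpa using hc)).1 key'

theorem integrable_of_lintegral_ofReal_ne_top {α : Type*} [MeasurableSpace α] {μ : Measure α}
    {f : α → ℝ} (hmeas : Measurable f) (h0 : ∀ x, 0 ≤ f x)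
    (hfin : ∫⁻ x, ENNReal.ofReal (f x) ∂μ ≠ ⊤) : Integrable f μ :=
  ⟨hmeas.aestronglyMeasurable,
    (hasFiniteIntegral_iff_ofReal (Filter.Eventually.of_forall h0)).2 hfin.lt_top⟩

section LogConcave

variable {E : Type*} [NormedAddCommGroup E] [NormedSpace ℝ E] {f : E → ℝ}

theorem LogConcaveFun.convex_superlevel (hlc : LogConcaveFun f) {c : ℝ} (hc : 0 < c) :
    Convex ℝ {x | c ≤ f x} := by
  intro x hx y hy a b ha hb hab
  obtain rfl : b = 1 - a := by linarith
  refine le_trans ?_ (hlc x y a ha (by linarith))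
  calc c = c ^ a * c ^ (1 - a) := by rw [← Real.rpow_add hc]; simp
    _ ≤ _ := mul_le_mul (Real.rpow_le_rpow hc.le hx ha) (Real.rpow_le_rpow hc.le hy hb)
      (by positivity) (Real.rpow_nonneg (hc.le.trans hx) _)

theorem LogConcaveFun.convex_support (hlc : LogConcaveFun f) : Convex ℝ {x | 0 < f x} := by
  intro x hx y hy a b ha hb hab
  obtain rfl : b = 1 - a := by linarith
  exact lt_of_lt_of_le (mul_pos (Real.rpow_pos_of_pos hx _) (Real.rpow_pos_of_pos hy _))
    (hlc x y a ha (by linarith))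

/-- Line integrals of a log-concave function are log-concave. -/
theorem LogConcaveFun.lintegral_line (hlc : LogConcaveFun f) (h0 : ∀ x, 0 ≤ f x)
    (hb : BddAbove (range f)) [MeasurableSpace E] [BorelSpace E] (hmeas : Measurable f)
    {I : Set ℝ} (hI : MeasurableSet I) (hIc : Convex ℝ I) (e x y : E) {s : ℝ} (hs0 : 0 < s)
    (hs1 : s < 1) :
    (∫⁻ u in I, ENNReal.ofReal (f (x + u • e))) ^ s *
      (∫⁻ u in I, ENNReal.ofReal (f (y + u • e))) ^ (1 - s) ≤
      ∫⁻ u in I, ENNReal.ofReal (f ((s • x + (1 - s) • y) + u • e)) := by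
  obtain ⟨M, hM⟩ := hb
  have hline : ∀ z : E, Measurable fun u : ℝ => f (z + u • e) := fun z =>
    hmeas.comp (by fun_prop : Continuous fun u : ℝ => z + u • e).measurable
  have hind : ∀ z : E, ∫⁻ u in I, ENNReal.ofReal (f (z + u • e)) =
      ∫⁻ u, ENNReal.ofReal (I.indicator (fun u => f (z + u • e)) u) := by
    intro z
    rw [← lintegral_indicator hI]
    congr 1 with u
    by_cases hu : u ∈ I <;> simp [hu]
  have hnn : ∀ z : E, ∀ u, 0 ≤ I.indicator (fun u => f (z + u • e)) u := fun z u =>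
    indicator_nonneg (fun _ _ => h0 _) _
  have hbd : ∀ z : E, BddAbove (range (I.indicator fun u => f (z + u • e))) := by
    refine fun z => ⟨M, ?_⟩
    rintro _ ⟨u, rfl⟩
    exact indicator_le' (fun u _ => hM ⟨_, rfl⟩) (fun u _ => (h0 0).trans (hM ⟨0, rfl⟩)) u
  simp_rw [hind]
  refine prekopaLeindler ((hline x).indicator hI) ((hline y).indicator hI) ((hline _).indicator hI)
    (hnn x) (hnn y) (hnn _) (hbd x) (hbd y) hs0 hs1 fun u v => ?_
  by_cases hu : u ∈ I
  · by_cases hv : v ∈ I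
    · have : s * u + (1 - s) * v ∈ I := hIc hu hv hs0.le (by linarith) (by ring)
      simp only [indicator_of_mem, hu, hv, this]
      refine (hlc _ _ s hs0.le hs1.le).trans_eq ?_
      congr 1
      module
    · rw [indicator_of_notMem hv, Real.zero_rpow (by linarith), mul_zero]
      exact hnn _ _
  · rw [indicator_of_notMem hu, Real.zero_rpow (by linarith), zero_mul]
    exact hnn _ _

variable [MeasurableSpace E] [BorelSpace E] {μ : Measure E} [μ.IsAddHaarMeasure]

theorem Real.min_rpow_le_rpow {m t : ℝ} (hm : 0 ≤ m) (h1 : 1 / 4 ≤ t) (h2 : t ≤ 1 / 2) :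
    min (m ^ (1 / 4 : ℝ)) (m ^ (1 / 2 : ℝ)) ≤ m ^ t := by
  rcases hm.eq_or_lt with rfl | hm
  · rw [Real.zero_rpow (by norm_num), Real.zero_rpow (by norm_num), Real.zero_rpow (by linarith)]
    simp
  rcases le_total 1 m with h | h
  · exact (min_le_left _ _).trans (Real.rpow_le_rpow_of_exponent_le h h1)
  · exact (min_le_right _ _).trans (Real.rpow_le_rpow_of_exponent_ge hm h h2)

/-- A log-concave function which is at least `c` on a ball is bounded below on a long chain of
disjoint balls directed towards any given point. -/
theorem LogConcaveFun.nsmul_ball_le (hlc : LogConcaveFun f) (h0 : ∀ x, 0 ≤ f x) {c r : ℝ}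
    (hc : 0 < c) (hr : 0 < r) {x₀ : E} (hball : ∀ x ∈ Metric.ball x₀ r, c ≤ f x) (x : E) :
    (⌊‖x - x₀‖ / (4 * r)⌋₊ + 1 : ℕ) * μ (Metric.ball 0 (r / 2)) *
      ENNReal.ofReal (c * min ((f x / c) ^ (1 / 4 : ℝ)) ((f x / c) ^ (1 / 2 : ℝ))) ≤
      ∫⁻ x, ENNReal.ofReal (f x) ∂μ := by
  set D := ‖x - x₀‖ with hD
  have hD0 : 0 ≤ D := norm_nonneg _
  set N := ⌊D / (4 * r)⌋₊ + 1 with hN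
  set φ := c * min ((f x / c) ^ (1 / 4 : ℝ)) ((f x / c) ^ (1 / 2 : ℝ)) with hφ
  let t : ℕ → ℝ := fun k => 1 / 4 + k * r / D
  let B : ℕ → Set E := fun k => Metric.ball (x₀ + t k • (x - x₀)) (r / 2)
  have hk : ∀ k < N, k * r ≤ D / 4 := by
    intro k hk
    have : (k : ℝ) ≤ D / (4 * r) :=
      (Nat.cast_le.2 (Nat.lt_succ_iff.1 hk)).trans (Nat.floor_le (by positivity))
    rw [le_div_iff₀ (by positivity)] at this
    linarith
  have ht1 : ∀ k, 1 / 4 ≤ t k := fun k => by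
    have : 0 ≤ k * r / D := by positivity
    simp only [t]; linarith
  have ht2 : ∀ k < N, t k ≤ 1 / 2 := fun k hkN => by
    have : k * r / D ≤ 1 / 4 := div_le_of_le_mul₀ hD0 (by norm_num) (by linarith [hk k hkN])
    simp only [t]; linarith
  have hval : ∀ k < N, ∀ z ∈ B k, φ ≤ f z := by
    intro k hkN z hz
    have h1 := ht1 k
    have h2 := ht2 k hkN
    have h3 : 0 < 1 - t k := by linarith
    set w := x₀ + (1 - t k)⁻¹ • (z - (x₀ + t k • (x - x₀))) with hw
    have hwb : w ∈ Metric.ball x₀ r := by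
      rw [Metric.mem_ball, dist_eq_norm] at hz ⊢
      rw [hw, add_sub_cancel_left, norm_smul, Real.norm_of_nonneg (by positivity),
        inv_mul_lt_iff₀ h3]
      nlinarith
    have hz' : t k • x + (1 - t k) • w = z := by
      rw [hw, smul_add, smul_inv_smul₀ h3.ne']
      module
    have := hlc x w (t k) (by linarith) (by linarith)
    rw [hz'] at this
    refine le_trans ?_ this
    calc φ ≤ c * (f x / c) ^ t k := by
          rw [hφ]; gcongr
          exact Real.min_rpow_le_rpow (div_nonneg (h0 x) hc.le) h1 h2
      _ = f x ^ t k * c ^ (1 - t k) := by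
          rw [Real.div_rpow (h0 x) hc.le, Real.rpow_sub hc, Real.rpow_one]
          field_simp
      _ ≤ _ := mul_le_mul_of_nonneg_left (Real.rpow_le_rpow hc.le (hball w hwb) h3.le)
          (Real.rpow_nonneg (h0 x) _)
  have hdisj : ((Finset.range N : Finset ℕ) : Set ℕ).PairwiseDisjoint B := by
    intro j hj k hk' hjk
    simp only [Finset.coe_range, mem_Iio] at hj hk'
    apply Metric.ball_disjoint_ball
    have hDpos : 0 < D := by
      by_contra! hD'
      have hDz : D = 0 := le_antisymm hD' hD0
      simp [hN, hDz] at hj hk'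
      omega
    rw [dist_eq_norm, add_sub_add_left_eq_sub, ← sub_smul, norm_smul, ← hD]
    have : t j - t k = (j - k) * r / D := by simp only [t]; ring
    rw [this, Real.norm_eq_abs, abs_div, abs_mul, abs_of_pos hDpos, abs_of_pos hr,
      div_mul_cancel₀ _ hDpos.ne']
    have : (1 : ℝ) ≤ |(j : ℝ) - k| := by
      have : (1 : ℤ) ≤ |(j : ℤ) - k| := Int.one_le_abs (by omega)
      exact_mod_cast this
    nlinarith
  have hmeasU : MeasurableSet (⋃ k ∈ Finset.range N, B k) :=
    Finset.measurableSet_biUnion _ fun k _ => Metric.isOpen_ball.measurableSet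
  calc (N : ℝ≥0∞) * μ (Metric.ball 0 (r / 2)) * ENNReal.ofReal φ
      = ENNReal.ofReal φ * μ (⋃ k ∈ Finset.range N, B k) := by
        rw [measure_biUnion_finset hdisj fun k _ => Metric.isOpen_ball.measurableSet,
          Finset.sum_congr rfl fun k _ => Measure.addHaar_ball_center μ _ _]
        simp [mul_comm]
    _ = ∫⁻ _ in ⋃ k ∈ Finset.range N, B k, ENNReal.ofReal φ ∂μ := by simp
    _ ≤ ∫⁻ z in ⋃ k ∈ Finset.range N, B k, ENNReal.ofReal (f z) ∂μ := by
        refine setLIntegral_mono' hmeasU fun z hz => ENNReal.ofReal_le_ofReal ?_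
        simp only [mem_iUnion, Finset.mem_range] at hz
        obtain ⟨k, hkN, hz⟩ := hz
        exact hval k hkN z hz
    _ ≤ _ := setLIntegral_le_lintegral _ _

variable [FiniteDimensional ℝ E]

theorem Convex.interior_nonempty_of_measure_ne_zero (μ : Measure E) [μ.IsAddHaarMeasure]
    {S : Set E} (hS : Convex ℝ S) (h : μ S ≠ 0) : (interior S).Nonempty := by
  by_contra hne
  rw [not_nonempty_iff_eq_empty] at hne
  refine h (measure_mono_null ?_ (hS.addHaar_frontier μ))
  rw [frontier, hne, sdiff_empty]
  exact subset_closure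

theorem LogConcaveFun.exists_ball (hlc : LogConcaveFun f)
    (hpos : ∫⁻ x, ENNReal.ofReal (f x) ∂μ ≠ 0) :
    ∃ c > 0, ∃ x₀, ∃ r > 0, ∀ x ∈ Metric.ball x₀ r, c ≤ f x := by
  obtain ⟨n, hn⟩ : ∃ n : ℕ, μ {x | 1 / ((n : ℝ) + 1) ≤ f x} ≠ 0 := by
    by_contra! h
    apply hpos
    have : ∀ᵐ x ∂μ, ∀ n : ℕ, ¬ 1 / ((n : ℝ) + 1) ≤ f x := by
      rw [ae_all_iff]
      intro n
      simpa [ae_iff] using h n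
    rw [lintegral_congr_ae (g := fun _ => 0), lintegral_zero]
    filter_upwards [this] with x hx
    rw [ENNReal.ofReal_eq_zero]
    by_contra! hx0
    obtain ⟨n, hn⟩ := exists_nat_one_div_lt hx0
    exact hx n hn.le
  have hc : 0 < 1 / ((n : ℝ) + 1) := by positivity
  obtain ⟨x₀, hx₀⟩ := (hlc.convex_superlevel hc).interior_nonempty_of_measure_ne_zero μ hn
  obtain ⟨r, hr, h⟩ := Metric.isOpen_iff.1 isOpen_interior x₀ hx₀
  refine ⟨_, hc, x₀, r, hr, fun x hx => ?_⟩
  have : x ∈ {x | 1 / ((n : ℝ) + 1) ≤ f x} := interior_subset (h hx)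
  exact this

theorem LogConcaveFun.ae_mem_interior_support (hlc : LogConcaveFun f) (h0 : ∀ x, 0 ≤ f x)
    (μ : Measure E) [μ.IsAddHaarMeasure] :
    ∀ᵐ x ∂μ, f x = 0 ∨ x ∈ interior {x | 0 < f x} := by
  have : ∀ᵐ x ∂μ, x ∉ frontier {x | 0 < f x} :=
    measure_eq_zero_iff_ae_notMem.1 (hlc.convex_support.addHaar_frontier μ)
  filter_upwards [this] with x hx
  by_contra! h
  exact hx ⟨subset_closure ((h0 x).lt_of_ne' h.1), h.2⟩

theorem LogConcaveFun.exists_decay (hlc : LogConcaveFun f) (h0 : ∀ x, 0 ≤ f x)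
    (hpos : ∫⁻ x, ENNReal.ofReal (f x) ∂μ ≠ 0) (hfin : ∫⁻ x, ENNReal.ofReal (f x) ∂μ ≠ ⊤) :
    ∃ K, ∀ x, (1 + ‖x‖) * √(f x) ≤ K := by
  obtain ⟨c, hc, x₀, r, hr, hball⟩ := hlc.exists_ball hpos
  set Z := (∫⁻ x, ENNReal.ofReal (f x) ∂μ).toReal
  set b := (μ (Metric.ball (0 : E) (r / 2))).toReal with hb
  have hb0 : 0 < b := ENNReal.toReal_pos (Metric.measure_ball_pos μ _ (by positivity)).ne'
    measure_ball_lt_top.ne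
  have hZ : 0 ≤ Z := ENNReal.toReal_nonneg
  set A := 1 + ‖x₀‖ + 4 * r with hA
  set L := A * (Z / (b * c)) with hL
  have hmin : ∀ x, (1 + ‖x‖) * min ((f x / c) ^ (1 / 4 : ℝ)) ((f x / c) ^ (1 / 2 : ℝ)) ≤ L := by
    intro x
    set ψ := min ((f x / c) ^ (1 / 4 : ℝ)) ((f x / c) ^ (1 / 2 : ℝ)) with hψ
    have hm : 0 ≤ f x / c := div_nonneg (h0 x) hc.le
    have hψ0 : 0 ≤ ψ := le_min (Real.rpow_nonneg hm _) (Real.rpow_nonneg hm _)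
    have h := ENNReal.toReal_mono hfin (hlc.nsmul_ball_le (μ := μ) h0 hc hr hball x)
    rw [ENNReal.toReal_mul, ENNReal.toReal_mul, ENNReal.toReal_natCast,
      ENNReal.toReal_ofReal (by positivity), ← hψ, ← hb] at h
    set N : ℝ := ((⌊‖x - x₀‖ / (4 * r)⌋₊ + 1 : ℕ) : ℝ) with hN
    have hN1 : 1 ≤ N := by simp [hN]
    have hN2 : ‖x - x₀‖ ≤ 4 * r * N := by
      have : ‖x - x₀‖ / (4 * r) < N := by simpa [hN] using Nat.lt_floor_add_one _
      rw [div_lt_iff₀ (by positivity)] at this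
      linarith
    have hx : 1 + ‖x‖ ≤ A * N := by
      have : ‖x‖ ≤ ‖x - x₀‖ + ‖x₀‖ := by simpa using norm_add_le (x - x₀) x₀
      have := norm_nonneg x₀
      nlinarith
    have hNψ : N * ψ ≤ Z / (b * c) := by
      rw [le_div_iff₀ (by positivity)]
      linarith
    calc (1 + ‖x‖) * ψ ≤ A * N * ψ := by gcongr
      _ = A * (N * ψ) := by ring
      _ ≤ L := by rw [hL]; gcongr
  have hL0 : 0 ≤ L := by positivity
  refine ⟨√c * (L + L ^ 2), fun x => ?_⟩
  set m := f x / c with hm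
  have hm0 : 0 ≤ m := div_nonneg (h0 x) hc.le
  have hfm : √(f x) = √c * √m := by
    rw [← Real.sqrt_mul hc.le, hm, mul_div_cancel₀ _ hc.ne']
  have hx0 := norm_nonneg x
  rw [hfm, mul_left_comm]
  refine mul_le_mul_of_nonneg_left ?_ (Real.sqrt_nonneg _)
  have h := hmin x
  rw [← hm, ← Real.sqrt_eq_rpow] at h
  set q := m ^ (1 / 4 : ℝ) with hq
  have hq0 : 0 ≤ q := Real.rpow_nonneg hm0 _
  have hqm : √m = q * q := by
    rw [hq, ← Real.rpow_add_of_nonneg hm0 (by norm_num) (by norm_num), Real.sqrt_eq_rpow]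
    norm_num
  rcases le_total q (√m) with hle | hle
  · rw [min_eq_left hle] at h
    have hqL : q ≤ L := by nlinarith
    rw [hqm]
    nlinarith
  · rw [min_eq_right hle] at h
    nlinarith [sq_nonneg L]

theorem LogConcaveFun.bddAbove (hlc : LogConcaveFun f) (h0 : ∀ x, 0 ≤ f x)
    (hpos : ∫⁻ x, ENNReal.ofReal (f x) ∂μ ≠ 0) (hfin : ∫⁻ x, ENNReal.ofReal (f x) ∂μ ≠ ⊤) :
    BddAbove (range f) := by
  obtain ⟨K, hK⟩ := hlc.exists_decay h0 hpos hfin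
  refine ⟨K ^ 2, ?_⟩
  rintro _ ⟨x, rfl⟩
  have h1 : √(f x) ≤ K := by nlinarith [hK x, norm_nonneg x, Real.sqrt_nonneg (f x)]
  exact (Real.sqrt_le_left ((Real.sqrt_nonneg _).trans h1)).1 h1

theorem LogConcaveFun.integrable_smul_id (hlc : LogConcaveFun f) (hmeas : Measurable f)
    (h0 : ∀ x, 0 ≤ f x) (hpos : ∫⁻ x, ENNReal.ofReal (f x) ∂μ ≠ 0)
    (hfin : ∫⁻ x, ENNReal.ofReal (f x) ∂μ ≠ ⊤) : Integrable (fun x => f x • x) μ := by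
  obtain ⟨K, hK⟩ := hlc.exists_decay h0 hpos hfin
  obtain ⟨c, hc, x₀, r, hr, hball⟩ := hlc.exists_ball hpos
  have hint : Integrable (fun x => f ((1 / 2 : ℝ) • x + (1 / 2 : ℝ) • x₀)) μ :=
    ((integrable_of_lintegral_ofReal_ne_top hmeas h0 hfin).comp_add_right _).comp_smul (by norm_num)
  refine (hint.const_mul (K / √c)).mono' (hmeas.smul measurable_id).aestronglyMeasurable
    (Filter.Eventually.of_forall fun x => ?_)
  have h1 := hlc x x₀ (1 / 2) (by norm_num) (by norm_num)
  rw [show (1 - 1 / 2 : ℝ) = 1 / 2 by norm_num, ← Real.sqrt_eq_rpow, ← Real.sqrt_eq_rpow] at h1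
  have h2 : √c ≤ √(f x₀) := Real.sqrt_le_sqrt (hball x₀ (Metric.mem_ball_self hr))
  have hsc : 0 < √c := Real.sqrt_pos.2 hc
  have hsx := Real.sqrt_nonneg (f x)
  have hx0 := norm_nonneg x
  have hKx := hK x
  have hK0 : 0 ≤ K := le_trans (by positivity) hKx
  have h3 : √(f x) ≤ f ((1 / 2 : ℝ) • x + (1 / 2 : ℝ) • x₀) / √c := by
    rw [le_div_iff₀ hsc]
    exact (mul_le_mul_of_nonneg_left h2 hsx).trans h1
  rw [norm_smul, Real.norm_of_nonneg (h0 x)]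
  calc f x * ‖x‖ = √(f x) * (‖x‖ * √(f x)) := by nth_rw 1 [← Real.mul_self_sqrt (h0 x)]; ring
    _ ≤ √(f x) * K := by gcongr; nlinarith
    _ ≤ (f ((1 / 2 : ℝ) • x + (1 / 2 : ℝ) • x₀) / √c) * K := by gcongr
    _ = _ := by ring

theorem LogConcaveFun.zero_mem_interior_support (hlc : LogConcaveFun f) (hmeas : Measurable f)
    (h0 : ∀ x, 0 ≤ f x) (hpos : ∫⁻ x, ENNReal.ofReal (f x) ∂μ ≠ 0)
    (hfin : ∫⁻ x, ENNReal.ofReal (f x) ∂μ ≠ ⊤) (hcentred : ∫ x, f x • x ∂μ = 0) :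
    (0 : E) ∈ interior {x | 0 < f x} := by
  by_contra hmem
  obtain ⟨g, hg⟩ :=
    geometric_hahn_banach_open_point hlc.convex_support.interior isOpen_interior hmem
  rw [map_zero] at hg
  have hint := hlc.integrable_smul_id hmeas h0 hpos hfin
  have hz : ∫ x, -g (f x • x) ∂μ = 0 := by
    rw [integral_neg, g.integral_comp_comm hint, hcentred, map_zero, neg_zero]
  have hae := hlc.ae_mem_interior_support h0 μ
  have hnn : 0 ≤ᵐ[μ] fun x => -g (f x • x) := by
    filter_upwards [hae] with x hx
    rcases hx with hx | hx
    · simp [hx]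
    · have := mul_nonpos_of_nonneg_of_nonpos (h0 x) (hg x hx).le
      simpa using this
  rw [integral_eq_zero_iff_of_nonneg_ae hnn (g.integrable_comp hint).neg] at hz
  have hnull : μ (interior {x | 0 < f x}) = 0 := by
    rw [measure_eq_zero_iff_ae_notMem]
    filter_upwards [hz] with x hx hxU
    have h1 : 0 < f x := interior_subset (s := {x | 0 < f x}) hxU
    have h2 := mul_neg_of_pos_of_neg h1 (hg x hxU)
    simp only [map_smul, smul_eq_mul, Pi.zero_apply, neg_eq_zero] at hx
    linarith
  have hS : μ {x | 0 < f x} ≠ 0 := by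
    intro hS
    apply hpos
    rw [lintegral_congr_ae (g := fun _ => 0), lintegral_zero]
    filter_upwards [measure_eq_zero_iff_ae_notMem.1 hS] with x hx
    simpa using hx
  exact (isOpen_interior.measure_pos μ
    (hlc.convex_support.interior_nonempty_of_measure_ne_zero μ hS)).ne' hnull

end LogConcave

/-- A concave function on an open convex set has a supergradient at each point. -/
theorem ConcaveOn.exists_supergradient {E : Type*} [NormedAddCommGroup E] [NormedSpace ℝ E]
    [FiniteDimensional ℝ E] {U : Set E} {φ : E → ℝ}
    (hφ : ConcaveOn ℝ U φ) (hU : IsOpen U) {x₀ : E} (hx₀ : x₀ ∈ U) :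
    ∃ a : E →L[ℝ] ℝ, ∀ x ∈ U, φ x ≤ φ x₀ + a (x - x₀) := by
  have hopen : IsOpen {p : E × ℝ | p.1 ∈ U ∧ p.2 < φ p.1} := by
    rw [isOpen_iff_mem_nhds]
    rintro ⟨x, r⟩ ⟨hx, hr⟩
    have hc : ContinuousAt (fun p : E × ℝ => φ p.1) (x, r) :=
      ContinuousAt.comp (f := Prod.fst) ((hφ.continuousOn hU).continuousAt (hU.mem_nhds hx))
        continuousAt_fst
    filter_upwards [continuousAt_fst.preimage_mem_nhds (hU.mem_nhds hx),
      continuousAt_snd.eventually_lt hc hr] with p h1 h2 using ⟨h1, h2⟩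
  obtain ⟨g, hg⟩ := geometric_hahn_banach_open_point hφ.convex_strict_hypograph hopen
    (x := (x₀, φ x₀)) (fun h => lt_irrefl _ h.2)
  have hsplit : ∀ x r, g (x, r) = g (x, 0) + r * g (0, 1) := by
    intro x r
    rw [← smul_eq_mul, ← map_smul, ← map_add]
    simp
  have hb : 0 < g (0, 1) := by
    have := hg (x₀, φ x₀ - 1) ⟨hx₀, by simp⟩
    rw [hsplit, hsplit x₀ (φ x₀)] at this
    linarith
  refine ⟨-(g (0, 1))⁻¹ • g.comp (ContinuousLinearMap.inl ℝ E ℝ), fun x hx => ?_⟩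
  have key : g (x, 0) + φ x * g (0, 1) ≤ g (x₀, 0) + φ x₀ * g (0, 1) := by
    refine le_of_forall_pos_lt_add fun ε hε => ?_
    have := hg (x, φ x - ε / g (0, 1)) ⟨hx, by simp; positivity⟩
    rw [hsplit, hsplit x₀ (φ x₀), sub_mul, div_mul_cancel₀ _ hb.ne'] at this
    linarith
  have hsub : g (x - x₀, 0) = g (x, 0) - g (x₀, 0) := by
    rw [← map_sub]; simp
  simp only [_root_.smul_apply, ContinuousLinearMap.comp_apply,
    ContinuousLinearMap.inl_apply, hsub, smul_eq_mul]
  rw [← sub_le_iff_le_add', neg_mul, ← sub_nonneg]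
  have : -((g (0, 1))⁻¹ * (g (x, 0) - g (x₀, 0))) - (φ x - φ x₀) =
      (g (0, 1))⁻¹ * (g (x₀, 0) + φ x₀ * g (0, 1) - (g (x, 0) + φ x * g (0, 1))) := by
    field_simp
    ring
  rw [this]
  exact mul_nonneg (by positivity) (by linarith)

theorem measure_setOf_measure_Ioi_lt_le (μ : Measure ℝ) [NullSingletonClass μ] (v : ℝ≥0∞) :
    μ {t | μ (Ioi t) < v} ≤ v := by
  set D := {t | μ (Ioi t) < v} with hD
  have hup : ∀ a ∈ D, ∀ b, a ≤ b → b ∈ D := fun a ha b hab =>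
    (measure_mono (Ioi_subset_Ioi hab)).trans_lt ha
  let Q : Set ℚ := {q | (q : ℝ) ∈ D}
  have hcov : D ⊆ (⋃ q ∈ Q, Ioi (q : ℝ)) ∪ {x | x ∈ D ∧ ∀ d ∈ D, x ≤ d} := by
    intro x hx
    by_cases hmin : ∀ d ∈ D, x ≤ d
    · exact Or.inr ⟨hx, hmin⟩
    · push Not at hmin
      obtain ⟨d, hd, hdx⟩ := hmin
      obtain ⟨q, hdq, hqx⟩ := exists_rat_btwn hdx
      exact Or.inl (mem_biUnion (x := q) (hup d hd q hdq.le) hqx)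
  have hsub : {x | x ∈ D ∧ ∀ d ∈ D, x ≤ d}.Subsingleton := fun x hx y hy =>
    le_antisymm (hx.2 y hy.1) (hy.2 x hx.1)
  refine (measure_mono hcov).trans ((measure_union_le _ _).trans ?_)
  rw [hsub.measure_zero, add_zero, measure_biUnion_eq_iSup (Set.to_countable Q)]
  · exact iSup₂_le fun q hq => le_of_lt hq
  · intro q hq r hr
    rcases le_total q r with h | h
    · exact ⟨q, hq, subset_rfl, Ioi_subset_Ioi (by exact_mod_cast h)⟩
    · exact ⟨r, hr, Ioi_subset_Ioi (by exact_mod_cast h), subset_rfl⟩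

theorem lintegral_Ioc_rpow {r c : ℝ} (hr : -1 < r) (hc : 0 ≤ c) :
    ∫⁻ t in Ioc 0 c, ENNReal.ofReal (t ^ r) = ENNReal.ofReal (c ^ (r + 1) / (r + 1)) := by
  rw [← ofReal_integral_eq_lintegral_ofReal, ← intervalIntegral.integral_of_le hc,
    integral_rpow (Or.inl hr), Real.zero_rpow (by linarith), sub_zero]
  · exact ((intervalIntegrable_iff_integrableOn_Ioc_of_le hc).1
      (intervalIntegral.intervalIntegrable_rpow' hr))
  · exact (ae_restrict_iff' measurableSet_Ioc).2
      (Filter.Eventually.of_forall fun t ht => Real.rpow_nonneg ht.1.le _)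

theorem lintegral_Ioi_rpow {r c : ℝ} (hr : r < -1) (hc : 0 < c) :
    ∫⁻ t in Ioi c, ENNReal.ofReal (t ^ r) = ENNReal.ofReal (-c ^ (r + 1) / (r + 1)) := by
  rw [← ofReal_integral_eq_lintegral_ofReal, integral_Ioi_rpow_of_lt hr hc]
  · exact integrableOn_Ioi_rpow_of_lt hr hc
  · exact (ae_restrict_iff' measurableSet_Ioi).2
      (Filter.Eventually.of_forall fun t ht => Real.rpow_nonneg (hc.le.trans (le_of_lt ht)) _)

/-- For a finite atomless measure, the tail function `t ↦ μ (Ioi t)` is uniformly distributed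
under `μ`; this is the resulting bound for its negative moments. -/
theorem lintegral_inv_measure_Ioi_rpow_le (μ : Measure ℝ) [IsFiniteMeasure μ]
    [NullSingletonClass μ] {p : ℝ} (hp0 : 0 < p) (hp1 : p < 1) :
    ∫⁻ t, ENNReal.ofReal ((μ (Ioi t)).toReal⁻¹ ^ p) ∂μ ≤
      ENNReal.ofReal (1 / (1 - p)) * μ univ ^ (1 - p) := by
  rcases eq_or_ne μ 0 with rfl | hμ
  · simp
  set H := (μ univ).toReal with hH
  have hHpos : 0 < H := ENNReal.toReal_pos (by simpa using hμ) (measure_ne_top _ _)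
  have hHe : μ univ = ENNReal.ofReal H := (ENNReal.ofReal_toReal (measure_ne_top _ _)).symm
  have hmeas' : Measurable fun t => (μ (Ioi t)).toReal⁻¹ := by
    have : Measurable fun t => μ (Ioi t) :=
      Antitone.measurable fun a b hab => measure_mono (Ioi_subset_Ioi hab)
    exact this.ennreal_toReal.inv
  rw [lintegral_rpow_eq_lintegral_meas_lt_mul μ (Filter.Eventually.of_forall fun t => by simp)
    hmeas'.aemeasurable hp0]
  have htail : ∀ t > 0, μ {a | t < (μ (Ioi a)).toReal⁻¹} ≤ ENNReal.ofReal t⁻¹ := by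
    intro t ht
    refine le_trans (measure_mono fun a ha => ?_)
      (measure_setOf_measure_Ioi_lt_le μ (ENNReal.ofReal t⁻¹))
    rw [mem_ofPred_eq] at ha ⊢
    rw [ENNReal.lt_ofReal_iff_toReal_lt (measure_ne_top _ _)]
    exact lt_inv_of_lt_inv₀ ht ha
  have hHi : 0 < H⁻¹ := by positivity
  rw [← Ioc_union_Ioi_eq_Ioi hHi.le, lintegral_union measurableSet_Ioi Ioc_disjoint_Ioi_same]
  have h1 : ∫⁻ t in Ioc 0 H⁻¹, μ {a | t < (μ (Ioi a)).toReal⁻¹} * ENNReal.ofReal (t ^ (p - 1)) ≤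
      ENNReal.ofReal (H * (H⁻¹ ^ p / p)) := by
    rw [ENNReal.ofReal_mul hHpos.le]
    have := lintegral_Ioc_rpow (r := p - 1) (by linarith) hHi.le
    rw [sub_add_cancel] at this
    rw [← this, ← lintegral_const_mul' _ _ (by simp)]
    refine lintegral_mono fun t => ?_
    gcongr
    rw [← hHe]
    exact measure_mono (subset_univ _)
  have h2 : ∫⁻ t in Ioi H⁻¹, μ {a | t < (μ (Ioi a)).toReal⁻¹} * ENNReal.ofReal (t ^ (p - 1)) ≤
      ENNReal.ofReal (-H⁻¹ ^ (p - 2 + 1) / (p - 2 + 1)) := by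
    rw [← lintegral_Ioi_rpow (by linarith) hHi]
    refine setLIntegral_mono (by fun_prop) fun t ht => ?_
    have ht0 : 0 < t := hHi.trans ht
    refine (mul_le_mul_left (htail t ht0) _).trans_eq ?_
    rw [← ENNReal.ofReal_mul (by positivity), ← Real.rpow_neg_one, ← Real.rpow_add ht0]
    congr 2
    ring
  refine (mul_le_mul_right (add_le_add h1 h2) _).trans_eq ?_
  have hp1' : 0 < 1 - p := by linarith
  have e1 : H * (H⁻¹ ^ p / p) = H ^ (1 - p) / p := by
    rw [Real.inv_rpow hHpos.le, Real.rpow_sub hHpos, Real.rpow_one]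
    field_simp
  have e2 : -H⁻¹ ^ (p - 2 + 1) / (p - 2 + 1) = H ^ (1 - p) / (1 - p) := by
    rw [Real.inv_rpow hHpos.le, ← Real.rpow_neg hHpos.le,
      show -(p - 2 + 1) = 1 - p by ring, show p - 2 + 1 = -(1 - p) by ring, neg_div_neg_eq]
  rw [e1, e2, hHe, ENNReal.ofReal_rpow_of_pos hHpos, ← ENNReal.ofReal_add (by positivity)
    (by positivity), ← ENNReal.ofReal_mul hp0.le, ← ENNReal.ofReal_mul (by positivity)]
  congr 1
  field_simp
  ring

section Product

variable {F : Type*} [NormedAddCommGroup F] [NormedSpace ℝ F] [FiniteDimensional ℝ F]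
  [MeasurableSpace F] [BorelSpace F] {ν : Measure F} [ν.IsAddHaarMeasure] {f : ℝ × F → ℝ}

theorem lintegral_comp_smul_eq (ν : Measure F) [ν.IsAddHaarMeasure] {g : F → ℝ≥0∞}
    (hg : Measurable g) {s : ℝ} (hs : 0 < s) :
    ∫⁻ y, g (s • y) ∂ν = ENNReal.ofReal ((s ^ Module.finrank ℝ F)⁻¹) * ∫⁻ y, g y ∂ν := by
  rw [← lintegral_map hg (measurable_const_smul s), Measure.map_addHaar_smul ν hs.ne',
    lintegral_smul_measure, abs_of_pos (by positivity), smul_eq_mul]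

theorem setLIntegral_Ioi_zero_comp_add_left (g : ℝ → ℝ≥0∞) (t : ℝ) :
    ∫⁻ u in Ioi 0, g (t + u) = ∫⁻ v in Ioi t, g v := by
  rw [← lintegral_indicator measurableSet_Ioi, ← lintegral_indicator measurableSet_Ioi,
    ← lintegral_add_left_eq_self (fun v => (Ioi t).indicator g v) t]
  congr 1 with u
  simp [indicator]

theorem lintegral_mul_tail_rpow_le {g : ℝ → ℝ} (hg : Measurable g)
    (hfin : ∫⁻ t, ENNReal.ofReal (g t) ≠ ⊤) {p : ℝ} (hp0 : 0 < p) (hp1 : p < 1) :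
    ∫⁻ t, ENNReal.ofReal (g t) *
      ENNReal.ofReal ((∫⁻ u in Ioi 0, ENNReal.ofReal (g (t + u))).toReal⁻¹ ^ p) ≤
      ENNReal.ofReal (1 / (1 - p)) * (∫⁻ t, ENNReal.ofReal (g t)) ^ (1 - p) := by
  set d : ℝ → ℝ≥0∞ := fun t => ENNReal.ofReal (g t) with hd
  have hdm : Measurable d := hg.ennreal_ofReal
  set m := volume.withDensity d with hm
  have : IsFiniteMeasure m := isFiniteMeasure_withDensity hfin
  have : NullSingletonClass m := ⟨fun x =>
    withDensity_absolutelyContinuous volume d (measure_singleton x)⟩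
  have hmu : m univ = ∫⁻ t, d t := by rw [hm, withDensity_apply _ MeasurableSet.univ]; simp
  have htail : ∀ t, ∫⁻ u in Ioi 0, ENNReal.ofReal (g (t + u)) = m (Ioi t) := fun t => by
    rw [hm, withDensity_apply _ measurableSet_Ioi]
    exact setLIntegral_Ioi_zero_comp_add_left d t
  have key := lintegral_inv_measure_Ioi_rpow_le m hp0 hp1
  have hmeas : Measurable fun t => m (Ioi t) :=
    Antitone.measurable fun a b hab => measure_mono (Ioi_subset_Ioi hab)
  have hmeas' : Measurable fun t => ENNReal.ofReal ((m (Ioi t)).toReal⁻¹ ^ p) :=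
    (hmeas.ennreal_toReal.inv.pow_const p).ennreal_ofReal
  rw [hmu, lintegral_withDensity_eq_lintegral_mul _ hdm hmeas'] at key
  simp_rw [htail]
  exact key

theorem measurable_setLIntegral_line {E : Type*} [NormedAddCommGroup E] [NormedSpace ℝ E]
    [FiniteDimensional ℝ E] [MeasurableSpace E] [BorelSpace E] {f : E → ℝ} (hf : Measurable f)
    (I : Set ℝ) (e : E) : Measurable fun x => ∫⁻ u in I, ENNReal.ofReal (f (x + u • e)) := by
  apply Measurable.lintegral_prod_right'
    (f := fun p : E × ℝ => ENNReal.ofReal (f (p.1 + p.2 • e)))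
  have hc : Continuous fun p : E × ℝ => p.1 + p.2 • e := by fun_prop
  exact (hf.comp hc.measurable).ennreal_ofReal

theorem LogConcaveFun.lintegral_mul_tail_rpow_le (hlc : LogConcaveFun f) (hmeas : Measurable f)
    (h0 : ∀ x, 0 ≤ f x) (hpos : ∫⁻ x, ENNReal.ofReal (f x) ∂(volume.prod ν) ≠ 0)
    (hfin : ∫⁻ x, ENNReal.ofReal (f x) ∂(volume.prod ν) ≠ ⊤) {p : ℝ} (hp0 : 0 < p) (hp1 : p < 1) :
    (∫⁻ x, ENNReal.ofReal (f x) * ENNReal.ofReal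
      ((∫⁻ u in Ioi (0 : ℝ), ENNReal.ofReal (f (x + u • (1, 0)))).toReal⁻¹ ^ p) ∂(volume.prod ν)) *
      (∫⁻ u, ENNReal.ofReal (f (u, 0))) ^ p ≤
    ENNReal.ofReal (((1 - p) ^ (Module.finrank ℝ F + 1))⁻¹) *
      ∫⁻ x, ENNReal.ofReal (f x) ∂(volume.prod ν) := by
  set s := 1 - p with hs
  have hs0 : 0 < s := by linarith
  have hs1 : s < 1 := by linarith
  have hps : p = 1 - s := by linarith
  let H : F → ℝ≥0∞ := fun y => ∫⁻ u, ENNReal.ofReal (f (u, y))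
  have hHm : Measurable H := hmeas.ennreal_ofReal.lintegral_prod_left'
  have hZ : ∫⁻ x, ENNReal.ofReal (f x) ∂(volume.prod ν) = ∫⁻ y, H y ∂ν :=
    lintegral_prod_symm' _ hmeas.ennreal_ofReal
  have hHfin : ∀ᵐ y ∂ν, H y < ⊤ := ae_lt_top hHm (hZ ▸ hfin)
  have hGm := measurable_setLIntegral_line hmeas (Ioi 0) ((1, 0) : ℝ × F)
  have hscale : ∀ y, H y ^ s * H 0 ^ p ≤ H (s • y) := by
    intro y
    have := hlc.lintegral_line h0 (hlc.bddAbove h0 hpos hfin) hmeas MeasurableSet.univ convex_univ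
      ((1, 0) : ℝ × F) (0, y) (0, 0) hs0 hs1
    simpa [H, ← hps] using this
  have hfib : ∫⁻ x, ENNReal.ofReal (f x) * ENNReal.ofReal
      ((∫⁻ u in Ioi (0 : ℝ), ENNReal.ofReal (f (x + u • (1, 0)))).toReal⁻¹ ^ p) ∂(volume.prod ν) ≤
      ∫⁻ y, ENNReal.ofReal s⁻¹ * H y ^ s ∂ν := by
    have hm2 : Measurable fun x : ℝ × F => ENNReal.ofReal (f x) * ENNReal.ofReal
        ((∫⁻ u in Ioi (0 : ℝ), ENNReal.ofReal (f (x + u • (1, 0)))).toReal⁻¹ ^ p) :=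
      hmeas.ennreal_ofReal.mul (hGm.ennreal_toReal.inv.pow_const p).ennreal_ofReal
    rw [lintegral_prod_symm' _ hm2]
    refine lintegral_mono_ae ?_
    filter_upwards [hHfin] with y hy
    have := _root_.lintegral_mul_tail_rpow_le (g := fun t => f (t, y))
      (hmeas.comp measurable_prodMk_right) hy.ne hp0 hp1
    rw [← hs, one_div] at this
    simpa using this
  calc _ ≤ (∫⁻ y, ENNReal.ofReal s⁻¹ * H y ^ s ∂ν) * H 0 ^ p := mul_le_mul_left hfib _
    _ = ENNReal.ofReal s⁻¹ * ∫⁻ y, H y ^ s * H 0 ^ p ∂ν := by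
        rw [lintegral_const_mul _ (by fun_prop), lintegral_mul_const _ (by fun_prop), mul_assoc]
    _ ≤ ENNReal.ofReal s⁻¹ * ∫⁻ y, H (s • y) ∂ν :=
        mul_le_mul_right (lintegral_mono hscale) _
    _ = _ := by
        rw [lintegral_comp_smul_eq ν hHm hs0, ← mul_assoc, ← ENNReal.ofReal_mul (by positivity),
          hZ, pow_succ, mul_inv, mul_comm (s⁻¹)]

end Product

section Tail

variable {E : Type*} [NormedAddCommGroup E] [NormedSpace ℝ E] [MeasurableSpace E] [BorelSpace E]
  {f : E → ℝ}

theorem lintegral_Ioi_line_ne_zero (hmeas : Measurable f) {x : E}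
    (hx : x ∈ interior {x | 0 < f x}) (e : E) :
    ∫⁻ u in Ioi (0 : ℝ), ENNReal.ofReal (f (x + u • e)) ≠ 0 := by
  have hline : Continuous fun u : ℝ => x + u • e := by fun_prop
  have hmem : (fun u : ℝ => x + u • e) ⁻¹' interior {x | 0 < f x} ∈ nhds (0 : ℝ) :=
    hline.continuousAt.preimage_mem_nhds (isOpen_interior.mem_nhds (by simpa using hx))
  obtain ⟨δ, hδ, hball⟩ := Metric.mem_nhds_iff.1 hmem
  refine (lt_of_lt_of_le ?_ (lintegral_mono_set
    (show Ioo (0 : ℝ) δ ⊆ Ioi 0 from Ioo_subset_Ioi_self))).ne'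
  have hm : Measurable fun u : ℝ => ENNReal.ofReal (f (x + u • e)) :=
    (hmeas.comp hline.measurable).ennreal_ofReal
  rw [setLIntegral_pos_iff hm]
  refine lt_of_lt_of_le (?_ : 0 < volume (Ioo 0 δ)) (measure_mono fun u hu => ⟨?_, hu⟩)
  · simpa using hδ
  · have hu' : u ∈ Metric.ball (0 : ℝ) δ := by
      rw [Metric.mem_ball, dist_zero_right, Real.norm_of_nonneg hu.1.le]
      exact hu.2
    have : 0 < f (x + u • e) := interior_subset (s := {x | 0 < f x}) (hball hu')
    simpa using this

theorem lintegral_line_ne_top_of_zero (hlc : LogConcaveFun f) (hmeas : Measurable f)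
    (h0 : ∀ x, 0 ≤ f x) (hb : BddAbove (range f)) (hmem : (0 : E) ∈ interior {x | 0 < f x}) (e : E)
    (hfin : ∫⁻ u in Ioi (0 : ℝ), ENNReal.ofReal (f (u • e)) ≠ ⊤) (x : E) :
    ∫⁻ u in Ioi (0 : ℝ), ENNReal.ofReal (f (x + u • e)) ≠ ⊤ := by
  intro htop
  have hnhds : (fun ε : ℝ => -(ε • x)) ⁻¹' interior {x | 0 < f x} ∈ nhds (0 : ℝ) :=
    (by fun_prop : Continuous fun ε : ℝ => -(ε • x)).continuousAt.preimage_mem_nhds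
      (isOpen_interior.mem_nhds (by simpa using hmem))
  obtain ⟨δ, hδ, hball⟩ := Metric.mem_nhds_iff.1 hnhds
  set ε := δ / 2
  have hε : 0 < ε := half_pos hδ
  have hy : -(ε • x) ∈ interior {x | 0 < f x} := by
    have hεb : ε ∈ Metric.ball (0 : ℝ) δ := by
      rw [Metric.mem_ball, dist_zero_right, Real.norm_of_nonneg hε.le]
      exact half_lt_self hδ
    exact hball hεb
  have hs1 : ε / (1 + ε) < 1 := by rw [div_lt_one (by positivity)]; linarith
  have key := hlc.lintegral_line h0 hb hmeas measurableSet_Ioi (convex_Ioi 0) e x (-(ε • x))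
    (show 0 < ε / (1 + ε) by positivity) hs1
  have hcomb : (ε / (1 + ε)) • x + (1 - ε / (1 + ε)) • -(ε • x) = 0 := by
    rw [smul_neg, smul_smul, ← sub_eq_add_neg, ← sub_smul,
      show ε / (1 + ε) - (1 - ε / (1 + ε)) * ε = 0 by field_simp; ring, zero_smul]
  rw [htop, ENNReal.top_rpow_of_pos (by positivity), ENNReal.top_mul, hcomb] at key
  · exact hfin (by simpa using key)
  · simp only [ne_eq, ENNReal.rpow_eq_zero_iff, not_or, not_and]
    exact ⟨fun h => absurd h (lintegral_Ioi_line_ne_zero hmeas hy e), fun _ => by linarith⟩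

theorem LogConcaveFun.concaveOn_log_tail (hlc : LogConcaveFun f) (hmeas : Measurable f)
    (h0 : ∀ x, 0 ≤ f x) (hb : BddAbove (range f)) (e : E)
    (hfin : ∀ x, ∫⁻ u in Ioi (0 : ℝ), ENNReal.ofReal (f (x + u • e)) ≠ ⊤) :
    ConcaveOn ℝ (interior {x | 0 < f x}) fun x =>
      Real.log (∫⁻ u in Ioi (0 : ℝ), ENNReal.ofReal (f (x + u • e))).toReal := by
  have hpos : ∀ x ∈ interior {x | 0 < f x},
      0 < (∫⁻ u in Ioi (0 : ℝ), ENNReal.ofReal (f (x + u • e))).toReal := fun x hx =>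
    ENNReal.toReal_pos (lintegral_Ioi_line_ne_zero hmeas hx e) (hfin x)
  refine concaveOn_iff_forall_pos.2 ⟨hlc.convex_support.interior,
    fun x hx y hy a b ha hb' hab => ?_⟩
  obtain rfl : b = 1 - a := by linarith
  have h := ENNReal.toReal_mono (hfin _) (hlc.lintegral_line h0 hb hmeas measurableSet_Ioi
    (convex_Ioi 0) e x y ha (by linarith))
  rw [ENNReal.toReal_mul, ← ENNReal.toReal_rpow, ← ENNReal.toReal_rpow] at h
  have hx' := hpos x hx
  have hy' := hpos y hy
  have h' := Real.log_le_log (by positivity) h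
  rwa [Real.log_mul (by positivity) (by positivity), Real.log_rpow hx', Real.log_rpow hy'] at h'

variable [FiniteDimensional ℝ E]

/-- Jensen-type lower bound for negative moments of the tail of a centred log-concave function. -/
theorem LogConcaveFun.tail_rpow_mul_le_lintegral {μ : Measure E} [μ.IsAddHaarMeasure]
    (hlc : LogConcaveFun f) (hmeas : Measurable f)
    (h0 : ∀ x, 0 ≤ f x) (hpos : ∫⁻ x, ENNReal.ofReal (f x) ∂μ ≠ 0)
    (hfin : ∫⁻ x, ENNReal.ofReal (f x) ∂μ ≠ ⊤) (hcentred : ∫ x, f x • x ∂μ = 0) (e : E)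
    (hline : ∫⁻ u in Ioi (0 : ℝ), ENNReal.ofReal (f (u • e)) ≠ ⊤) {p : ℝ} (hp : 0 < p) :
    ENNReal.ofReal ((∫⁻ u in Ioi (0 : ℝ), ENNReal.ofReal (f (u • e))).toReal⁻¹ ^ p) *
      ∫⁻ x, ENNReal.ofReal (f x) ∂μ ≤
    ∫⁻ x, ENNReal.ofReal (f x) * ENNReal.ofReal
      ((∫⁻ u in Ioi (0 : ℝ), ENNReal.ofReal (f (x + u • e))).toReal⁻¹ ^ p) ∂μ := by
  set G : E → ℝ := fun x => (∫⁻ u in Ioi (0 : ℝ), ENNReal.ofReal (f (x + u • e))).toReal with hG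
  have hmem := hlc.zero_mem_interior_support hmeas h0 hpos hfin hcentred
  have hb := hlc.bddAbove h0 hpos hfin
  have htop := lintegral_line_ne_top_of_zero hlc hmeas h0 hb hmem e hline
  have hGpos : ∀ x ∈ interior {x | 0 < f x}, 0 < G x := fun x hx =>
    ENNReal.toReal_pos (lintegral_Ioi_line_ne_zero hmeas hx e) (htop x)
  have hG0 : G 0 = (∫⁻ u in Ioi (0 : ℝ), ENNReal.ofReal (f (u • e))).toReal := by simp [hG]
  obtain ⟨a, ha⟩ := (hlc.concaveOn_log_tail hmeas h0 hb e htop).exists_supergradient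
    isOpen_interior hmem
  have hpt : ∀ x ∈ interior {x | 0 < f x}, (G 0)⁻¹ ^ p * (1 - p * a x) ≤ (G x)⁻¹ ^ p := by
    intro x hx
    have h1 := ha x hx
    rw [sub_zero] at h1
    have h2 : ∀ z, 0 < G z → (G z)⁻¹ ^ p = Real.exp (-(p * Real.log (G z))) := fun z hz => by
      rw [Real.rpow_def_of_pos (by positivity), Real.log_inv]
      congr 1; ring
    rw [h2 0 (hGpos 0 hmem), h2 x (hGpos x hx)]
    calc _ ≤ Real.exp (-(p * Real.log (G 0))) * Real.exp (-(p * a x)) := by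
          gcongr
          linarith [Real.add_one_le_exp (-(p * a x))]
      _ = Real.exp (-(p * (Real.log (G 0) + a x))) := by
          rw [← Real.exp_add]; congr 1; ring
      _ ≤ _ := by
          apply Real.exp_le_exp.2
          have := mul_le_mul_of_nonneg_left h1 hp.le
          linarith
  have hGm : Measurable G := (measurable_setLIntegral_line hmeas (Ioi 0) e).ennreal_toReal
  have hfi := integrable_of_lintegral_ofReal_ne_top hmeas h0 hfin
  have hai : Integrable (fun x => a (f x • x)) μ :=
    a.integrable_comp (hlc.integrable_smul_id hmeas h0 hpos hfin)
  have haz : ∫ x, a (f x • x) ∂μ = 0 := by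
    rw [a.integral_comp_comm (hlc.integrable_smul_id hmeas h0 hpos hfin), hcentred, map_zero]
  have hnn : ∀ x, 0 ≤ f x * (G x)⁻¹ ^ p := fun x =>
    mul_nonneg (h0 x) (Real.rpow_nonneg (inv_nonneg.2 ENNReal.toReal_nonneg) _)
  simp_rw [← ENNReal.ofReal_mul (h0 _)]
  change _ ≤ ∫⁻ x, ENNReal.ofReal (f x * (G x)⁻¹ ^ p) ∂μ
  rw [← hG0]
  rcases eq_or_ne (∫⁻ x, ENNReal.ofReal (f x * (G x)⁻¹ ^ p) ∂μ) ⊤ with h | h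
  · rw [h]; exact le_top
  have hΦ : Integrable (fun x => f x * (G x)⁻¹ ^ p) μ :=
    integrable_of_lintegral_ofReal_ne_top (by fun_prop) hnn h
  have hle : ∫ x, (G 0)⁻¹ ^ p * (f x - p * a (f x • x)) ∂μ ≤ ∫ x, f x * (G x)⁻¹ ^ p ∂μ := by
    refine integral_mono_ae ((hfi.sub (hai.const_mul p)).const_mul _) hΦ ?_
    filter_upwards [hlc.ae_mem_interior_support h0 μ] with x hx
    rcases hx with hx | hx
    · simp [hx]
    · have := mul_le_mul_of_nonneg_left (hpt x hx) (h0 x)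
      simp only [map_smul, smul_eq_mul]
      linarith
  rw [integral_const_mul, integral_sub hfi (hai.const_mul p), integral_const_mul, haz, mul_zero,
    sub_zero] at hle
  rw [← ofReal_integral_eq_lintegral_ofReal hfi (Filter.Eventually.of_forall h0),
    ← ofReal_integral_eq_lintegral_ofReal hΦ (Filter.Eventually.of_forall hnn),
    ← ENNReal.ofReal_mul (Real.rpow_nonneg (inv_nonneg.2 ENNReal.toReal_nonneg) _)]
  exact ENNReal.ofReal_le_ofReal hle

end Tail

theorem grunbaum_logconcave_prod {F : Type*} [NormedAddCommGroup F] [NormedSpace ℝ F]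
    [FiniteDimensional ℝ F] [MeasurableSpace F] [BorelSpace F] {ν : Measure F}
    [ν.IsAddHaarMeasure] {f : ℝ × F → ℝ} (hlc : LogConcaveFun f) (hmeas : Measurable f)
    (h0 : ∀ x, 0 ≤ f x) (hpos : ∫⁻ x, ENNReal.ofReal (f x) ∂(volume.prod ν) ≠ 0)
    (hfin : ∫⁻ x, ENNReal.ofReal (f x) ∂(volume.prod ν) ≠ ⊤)
    (hcentred : ∫ x, f x • x ∂(volume.prod ν) = 0) :
    Real.exp (-((Module.finrank ℝ F : ℝ) + 1)) * (∫⁻ u, ENNReal.ofReal (f (u, 0))).toReal ≤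
      (∫⁻ u in Ioi (0 : ℝ), ENNReal.ofReal (f (u, 0))).toReal := by
  set H := ∫⁻ u, ENNReal.ofReal (f (u, 0)) with hH
  set G := ∫⁻ u in Ioi (0 : ℝ), ENNReal.ofReal (f (u, 0)) with hG
  set n := Module.finrank ℝ F
  rcases eq_or_ne H ⊤ with hHt | hHt
  · simp [hHt]
  have hGt : G ≠ ⊤ := ne_top_of_le_ne_top hHt (setLIntegral_le_lintegral _ _)
  have hmem := hlc.zero_mem_interior_support hmeas h0 hpos hfin hcentred
  have hG0 : G ≠ 0 := by
    simpa using lintegral_Ioi_line_ne_zero hmeas hmem ((1, 0) : ℝ × F)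
  have hH0 : H ≠ 0 := fun h => hG0 (le_antisymm (h ▸ setLIntegral_le_lintegral _ _) bot_le)
  have hg : 0 < G.toReal := ENNReal.toReal_pos hG0 hGt
  have hh : 0 < H.toReal := ENNReal.toReal_pos hH0 hHt
  have key : ∀ p : ℝ, 0 < p → p < 1 →
      (1 - p) * (Real.log H.toReal - Real.log G.toReal) ≤ n + 1 := by
    intro p hp0 hp1
    have hp1' : 0 < 1 - p := by linarith
    have h1 := hlc.tail_rpow_mul_le_lintegral hmeas h0 hpos hfin hcentred ((1, 0) : ℝ × F)
      (by simpa using hGt) hp0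
    have h2 := hlc.lintegral_mul_tail_rpow_le hmeas h0 hpos hfin hp0 hp1
    have h3 := (mul_le_mul_left h1 (H ^ p)).trans h2
    have e : ∫⁻ u in Ioi (0 : ℝ), ENNReal.ofReal (f (u • ((1, 0) : ℝ × F))) = G := by simp [hG]
    rw [e, mul_right_comm, ENNReal.mul_le_mul_iff_left hpos hfin] at h3
    have h4 := ENNReal.toReal_mono (by simp) h3
    rw [ENNReal.toReal_mul, ENNReal.toReal_ofReal (by positivity),
      ENNReal.toReal_ofReal (by positivity), ← ENNReal.toReal_rpow] at h4
    have h5 := Real.log_le_log (by positivity) h4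
    rw [Real.log_mul (by positivity) (by positivity), Real.log_rpow (by positivity),
      Real.log_rpow hh, Real.log_inv, Real.log_inv, Real.log_pow] at h5
    have h6 := Real.one_sub_inv_le_log_of_pos hp1'
    have h7 : p * (Real.log H.toReal - Real.log G.toReal) ≤ (n + 1) * (p / (1 - p)) := by
      have : (1 : ℝ) - (1 - p)⁻¹ = -(p / (1 - p)) := by field_simp; ring
      rw [this] at h6
      have : (0 : ℝ) ≤ n + 1 := by positivity
      push_cast at h5
      nlinarith
    have h8 : p * ((1 - p) * (Real.log H.toReal - Real.log G.toReal)) ≤ p * (n + 1) := by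
      calc _ = (1 - p) * (p * (Real.log H.toReal - Real.log G.toReal)) := by ring
        _ ≤ (1 - p) * ((n + 1) * (p / (1 - p))) := by gcongr
        _ = _ := by field_simp
    exact le_of_mul_le_mul_left h8 hp0
  have hlim : Real.log H.toReal - Real.log G.toReal ≤ n + 1 := by
    have ht : Filter.Tendsto (fun p : ℝ => (1 - p) * (Real.log H.toReal - Real.log G.toReal))
        (nhdsWithin 0 (Ioi 0)) (nhds ((1 - 0) * (Real.log H.toReal - Real.log G.toReal))) :=
      ((by fun_prop : Continuous fun p : ℝ =>
        (1 - p) * (Real.log H.toReal - Real.log G.toReal)).tendsto 0).mono_left nhdsWithin_le_nhds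
    rw [sub_zero, one_mul] at ht
    refine le_of_tendsto ht ?_
    filter_upwards [Ioo_mem_nhdsGT (zero_lt_one' ℝ)] with p hp using key p hp.1 hp.2
  rw [← Real.exp_log hh, ← Real.exp_add, ← Real.le_log_iff_exp_le hg]
  linarith

/-- **Grünbaum-type inequality for centred log-concave functions
(Meyer–Nazarov–Ryabogin–Yaskin).**
Let `f : ℝ^ℓ → [0, ∞)` be log-concave with `0 < ∫ f < ∞` and barycentre at the origin.
Then for every unit vector `θ`, `∫₀^∞ f(tθ) dt ≥ e^{-ℓ} ∫_{-∞}^∞ f(tθ) dt`. -/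
theorem grunbaum_logconcave (ℓ : ℕ) (f : EuclideanSpace ℝ (Fin ℓ) → ℝ)
    (hmeas : Measurable f) (hnonneg : ∀ x, 0 ≤ f x) (hlc : LogConcaveFun f)
    (hpos : 0 < ∫⁻ x, ENNReal.ofReal (f x))
    (hfin : ∫⁻ x, ENNReal.ofReal (f x) ≠ ⊤)
    (hcentred : ∫ x, f x • x = (0 : EuclideanSpace ℝ (Fin ℓ)))
    (θ : EuclideanSpace ℝ (Fin ℓ)) (hθ : ‖θ‖ = 1) :
    Real.exp (-(ℓ : ℝ)) * ∫ t : ℝ, f (t • θ) ≤ ∫ t in Set.Ioi (0 : ℝ), f (t • θ) := by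
  have hθ0 : θ ≠ 0 := by rintro rfl; simp at hθ
  let F := (Submodule.span ℝ {θ})ᗮ
  let e : (ℝ × F) ≃L[ℝ] EuclideanSpace ℝ (Fin ℓ) :=
    (((LinearEquiv.toSpanNonzeroSingleton ℝ _ θ hθ0).prodCongr (LinearEquiv.refl ℝ F)).trans
      (Submodule.prodEquivOfIsCompl _ _
        (Submodule.isCompl_orthogonal (Submodule.span ℝ {θ})))).toContinuousLinearEquiv
  have he : ∀ t : ℝ, e (t, 0) = t • θ := by
    intro t
    simp [e]
  have hrank : (Module.finrank ℝ F : ℝ) + 1 = ℓ := by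
    have h := e.toLinearEquiv.finrank_eq
    rw [Module.finrank_prod, Module.finrank_self, finrank_euclideanSpace_fin] at h
    rw [add_comm]
    exact_mod_cast h
  let ν : Measure F := volume
  let m : Measure (EuclideanSpace ℝ (Fin ℓ)) := (volume.prod ν).map e
  have : m.IsAddHaarMeasure := e.isAddHaarMeasure_map _
  have hm : m = m.addHaarScalarFactor volume • volume := Measure.isAddLeftInvariant_eq_smul _ _
  set c := m.addHaarScalarFactor volume
  have hc : c ≠ 0 := (Measure.addHaarScalarFactor_pos_of_isAddHaarMeasure m volume).ne'
  have hem : MeasurableEmbedding e := e.toHomeomorph.measurableEmbedding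
  have hlint : ∫⁻ z, ENNReal.ofReal (f (e z)) ∂(volume.prod ν) =
      c * ∫⁻ x, ENNReal.ofReal (f x) := by
    rw [← hem.lintegral_map (fun x => ENNReal.ofReal (f x))]
    change ∫⁻ x, ENNReal.ofReal (f x) ∂m = _
    rw [hm, lintegral_smul_measure]
    rfl
  have hcent : ∫ z, f (e z) • z ∂(volume.prod ν) = 0 := by
    apply e.injective
    rw [← e.integral_comp_comm, map_zero]
    simp_rw [map_smul]
    rw [← hem.integral_map (fun x => f x • x)]
    change ∫ x, f x • x ∂m = 0
    rw [hm, integral_smul_nnreal_measure, hcentred, smul_zero]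
  have hlc' : LogConcaveFun fun z => f (e z) := fun x y t ht0 ht1 => by
    simpa only [map_add, map_smul] using hlc (e x) (e y) t ht0 ht1
  have key := grunbaum_logconcave_prod hlc' (hmeas.comp e.continuous.measurable)
    (fun z => hnonneg _) (by rw [hlint]; exact mul_ne_zero (by simpa using hc) hpos.ne')
    (by rw [hlint]; exact ENNReal.mul_ne_top (by simp) hfin) hcent
  simp only [he] at key
  rw [hrank] at key
  have hline : Measurable fun t : ℝ => f (t • θ) :=
    hmeas.comp (by fun_prop : Continuous fun t : ℝ => t • θ).measurable
  rwa [integral_eq_lintegral_of_nonneg_ae (Filter.Eventually.of_forall fun t => hnonneg _)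
      hline.aestronglyMeasurable,
    integral_eq_lintegral_of_nonneg_ae (Filter.Eventually.of_forall fun t => hnonneg _)
      hline.aestronglyMeasurable]
end

section
/- Let n ≥ 2 and let a = (a_1, ..., a_{n+1}) be a unit vector in ℝ^{n+1} with Σ_j a_j = 0 and a_1 ≥ a_2 ≥ ... ≥ a_{n+1}. Put u = a_1, v = −a_{n+1}, and σ = √(1 − u² − v²), and assume σ > 0. Then p_a(0) ≤ (1/σ) · (1 − exp(−σ/(u + v))). -/
open MeasureTheory ProbabilityTheory Real

/-- `p` is the (continuous) probability density of `∑ⱼ aⱼ Xⱼ`, where `X₁, X₂, ...` are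
i.i.d. standard exponential random variables (density `e^{-x} 1_{(0,∞)}(x)` on `ℝ`). -/
def IsExpSumDensity {m : ℕ} (a : Fin m → ℝ) (p : ℝ → ℝ) : Prop :=
  Continuous p ∧
    Measure.map (fun x : Fin m → ℝ => ∑ j, a j * x j) (Measure.pi fun _ => expMeasure 1)
      = volume.withDensity fun x => ENNReal.ofReal (p x)

open scoped ENNReal

/-- Multiplicative form of log-concavity (Pólya frequency of order two) for
`ℝ≥0∞`-valued functions on the line. -/
def IsPF2 (f : ℝ → ℝ≥0∞) : Prop :=
  ∀ x s t : ℝ, 0 ≤ s → 0 ≤ t → f x * f (x + s + t) ≤ f (x + s) * f (x + t)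

theorem ENNReal.mul_add_mul_le_mul_add_mul_of_le {a b c d : ℝ≥0∞} (hab : a ≤ b) (hcd : c ≤ d) :
    a * d + b * c ≤ a * c + b * d := by
  obtain ⟨k, rfl⟩ := exists_add_of_le hab
  obtain ⟨l, rfl⟩ := exists_add_of_le hcd
  calc a * (c + l) + (a + k) * c ≤ a * (c + l) + (a + k) * c + k * l := le_self_add
    _ = _ := by ring

theorem IsPF2.mul_le_mul {f : ℝ → ℝ≥0∞} (hf : IsPF2 f) {a b c d : ℝ} (hab : a ≤ b) (hac : a ≤ c)
    (h : a + d = b + c) : f a * f d ≤ f b * f c := by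
  have := hf a (b - a) (c - a) (by linarith) (by linarith)
  rwa [show a + (b - a) + (c - a) = d by linarith, add_sub_cancel, add_sub_cancel] at this

theorem lconvolution_mul_lconvolution {f g : ℝ → ℝ≥0∞} (hf : Measurable f) (hg : Measurable g)
    (y z α β : ℝ) :
    (f ⋆ₗ g) y * (f ⋆ₗ g) z
      = ∫⁻ r, ∫⁻ r', (f (r - α) * f (r' - β)) * (g (α + y - r) * g (β + z - r')) := by
  have hshift : ∀ y α : ℝ, (f ⋆ₗ g) y = ∫⁻ r, f (r - α) * g (α + y - r) := by
    intro y α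
    rw [lconvolution_def, ← lintegral_sub_right_eq_self _ α]
    refine lintegral_congr fun r => ?_
    ring_nf
  rw [hshift y α, hshift z β, ← lintegral_mul_const _ (by fun_prop)]
  refine lintegral_congr fun r => ?_
  rw [← lintegral_const_mul _ (by fun_prop)]
  refine lintegral_congr fun r' => ?_
  ring

/-- The basic composition formula: log-concavity is preserved by convolution. -/
theorem IsPF2.lconvolution {f g : ℝ → ℝ≥0∞} (hf : IsPF2 f) (hg : IsPF2 g)
    (hfm : Measurable f) (hgm : Measurable g) : IsPF2 (f ⋆ₗ g) := by
  intro x s t hs ht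
  set a : ℝ → ℝ → ℝ≥0∞ := fun r r' => f (r - 0) * f (r' - s) with ha
  set c : ℝ → ℝ → ℝ≥0∞ := fun r r' => g (0 + (x + s) - r) * g (s + (x + t) - r') with hc
  have hA : (f ⋆ₗ g) (x + s) * (f ⋆ₗ g) (x + t) = ∫⁻ r, ∫⁻ r', a r r' * c r r' :=
    lconvolution_mul_lconvolution hfm hgm _ _ _ _
  have hB : (f ⋆ₗ g) x * (f ⋆ₗ g) (x + s + t) = ∫⁻ r, ∫⁻ r', a r' r * c r r' := by
    rw [lconvolution_mul_lconvolution hfm hgm _ _ s 0]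
    refine lintegral_congr fun r => lintegral_congr fun r' => ?_
    simp only [ha, hc]
    ring_nf
  have hA' : (f ⋆ₗ g) (x + s) * (f ⋆ₗ g) (x + t) = ∫⁻ r, ∫⁻ r', a r' r * c r' r := by
    rw [hA, lintegral_lintegral_swap (by simp only [ha, hc]; fun_prop)]
  have hB' : (f ⋆ₗ g) x * (f ⋆ₗ g) (x + s + t) = ∫⁻ r, ∫⁻ r', a r r' * c r' r := by
    rw [hB, lintegral_lintegral_swap (by simp only [ha, hc]; fun_prop)]
  have haux : ∀ r r', r ≤ r' → a r' r ≤ a r r' := by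
    intro r r' h
    simp only [ha]
    rw [mul_comm]
    exact hf.mul_le_mul (by linarith) (by linarith) (by ring)
  have hcaux : ∀ r r', r ≤ r' → c r' r ≤ c r r' := by
    intro r r' h
    exact hg.mul_le_mul (by linarith) (by linarith) (by ring)
  have hpt : ∀ r r', a r' r * c r r' + a r r' * c r' r ≤ a r r' * c r r' + a r' r * c r' r := by
    intro r r'
    rcases le_total r r' with h | h
    · have h1 := haux r r' h
      have h2 := hcaux r r' h
      calc _ = a r' r * c r r' + a r r' * c r' r := rfl
        _ ≤ a r' r * c r' r + a r r' * c r r' :=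
          ENNReal.mul_add_mul_le_mul_add_mul_of_le h1 h2
        _ = _ := add_comm _ _
    · have h1 := haux r' r h
      have h2 := hcaux r' r h
      calc _ = a r r' * c r' r + a r' r * c r r' := add_comm _ _
        _ ≤ _ := ENNReal.mul_add_mul_le_mul_add_mul_of_le h1 h2
  have h2 : (f ⋆ₗ g) x * (f ⋆ₗ g) (x + s + t) + (f ⋆ₗ g) x * (f ⋆ₗ g) (x + s + t)
      ≤ (f ⋆ₗ g) (x + s) * (f ⋆ₗ g) (x + t) + (f ⋆ₗ g) (x + s) * (f ⋆ₗ g) (x + t) := by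
    calc _ = ∫⁻ r, ∫⁻ r', (a r' r * c r r' + a r r' * c r' r) := by
          rw [congrArg₂ (· + ·) hB hB', ← lintegral_add_left (by simp only [ha, hc]; fun_prop)]
          refine lintegral_congr fun r => ?_
          rw [lintegral_add_left (by simp only [ha, hc]; fun_prop)]
      _ ≤ ∫⁻ r, ∫⁻ r', (a r r' * c r r' + a r' r * c r' r) :=
          lintegral_mono fun r => lintegral_mono fun r' => hpt r r'
      _ = _ := by
          rw [congrArg₂ (· + ·) hA hA', ← lintegral_add_left (by simp only [ha, hc]; fun_prop)]
          refine lintegral_congr fun r => ?_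
          rw [lintegral_add_left (by simp only [ha, hc]; fun_prop)]
  rw [← two_mul, ← two_mul] at h2
  exact (ENNReal.mul_le_mul_iff_right (by simp) (by simp)).1 h2

theorem withDensity_map_equiv {α β : Type*} [MeasurableSpace α] [MeasurableSpace β]
    (e : α ≃ᵐ β) (μ : Measure α) (f : α → ℝ≥0∞) :
    (μ.withDensity f).map e = (μ.map e).withDensity (f ∘ e.symm) := by
  ext s hs
  rw [e.map_apply, withDensity_apply _ (e.measurable hs), withDensity_apply _ hs, e.restrict_map,
    lintegral_map_equiv]
  simp

/-- The density of `a * X` for a standard exponential `X` and `a ≠ 0`. -/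
noncomputable def scaledExpPDF (a x : ℝ) : ℝ≥0∞ :=
  ENNReal.ofReal |a⁻¹| * exponentialPDF 1 (a⁻¹ * x)

theorem measurable_exponentialPDF : Measurable (exponentialPDF 1) :=
  (measurable_exponentialPDFReal 1).ennreal_ofReal

theorem measurable_scaledExpPDF (a : ℝ) : Measurable (scaledExpPDF a) :=
  (measurable_exponentialPDF.comp (measurable_const_mul _)).const_mul _

theorem exponentialPDF_mul_le {a b c d : ℝ} (hab : a ≤ b) (hac : a ≤ c) (h : a + d = b + c) :
    exponentialPDF 1 a * exponentialPDF 1 d ≤ exponentialPDF 1 b * exponentialPDF 1 c := by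
  rcases lt_or_ge a 0 with ha | ha
  · simp [exponentialPDF_of_neg ha]
  · rw [exponentialPDF_of_nonneg ha, exponentialPDF_of_nonneg (by linarith : (0 : ℝ) ≤ b),
      exponentialPDF_of_nonneg (by linarith : (0 : ℝ) ≤ c),
      exponentialPDF_of_nonneg (by linarith : (0 : ℝ) ≤ d),
      ← ENNReal.ofReal_mul (by positivity), ← ENNReal.ofReal_mul (by positivity)]
    simp only [one_mul, ← Real.exp_add]
    rw [show -a + -d = -b + -c by linarith]

theorem isPF2_scaledExpPDF (a : ℝ) : IsPF2 (scaledExpPDF a) := by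
  intro x s t hs ht
  simp only [scaledExpPDF]
  rw [mul_mul_mul_comm, mul_mul_mul_comm _ _ _ (exponentialPDF 1 (a⁻¹ * (x + t)))]
  refine mul_le_mul_right ?_ _
  rcases le_total 0 a⁻¹ with h | h
  · exact exponentialPDF_mul_le (by nlinarith) (by nlinarith) (by ring)
  · rw [mul_comm]
    exact exponentialPDF_mul_le (by nlinarith) (by nlinarith) (by ring)

theorem map_mul_expMeasure {a : ℝ} (ha : a ≠ 0) :
    (expMeasure 1).map (fun x => a * x) = volume.withDensity (scaledExpPDF a) := by
  have h := withDensity_map_equiv (Homeomorph.mulLeft₀ a ha).toMeasurableEquiv volume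
    (exponentialPDF 1)
  have h1 : ((Homeomorph.mulLeft₀ a ha).toMeasurableEquiv : ℝ → ℝ) = fun x => a * x := rfl
  have h2 : ((Homeomorph.mulLeft₀ a ha).toMeasurableEquiv.symm : ℝ → ℝ) = fun x => a⁻¹ * x := rfl
  rw [h1, h2, Real.map_volume_mul_left ha, withDensity_smul_measure,
    ← withDensity_smul _ (measurable_exponentialPDF.comp (measurable_const_mul _))] at h
  exact h

theorem IsPF2.apply_zero_mul_lintegral_le {g : ℝ → ℝ≥0∞} (hg : IsPF2 g) (hgm : Measurable g)
    {φ : ℝ → ℝ≥0∞} (hφ : Measurable φ) :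
    g 0 * ∫⁻ r in Set.Ioi 0, (∫⁻ t in Set.Ioo 0 r, φ t) * g r
      ≤ (∫⁻ r in Set.Ioi 0, g r) * ∫⁻ r in Set.Ioi 0, φ r * g r := by
  have hswap : ∫⁻ r in Set.Ioi (0 : ℝ), (∫⁻ t in Set.Ioo 0 r, φ t) * g r
      = ∫⁻ t in Set.Ioi (0 : ℝ), ∫⁻ s in Set.Ioi (0 : ℝ), φ t * g (0 + s + t) := by
    have h1 : ∀ r : ℝ, (∫⁻ t in Set.Ioo 0 r, φ t) * g r
        = ∫⁻ t in Set.Ioi (0 : ℝ), (Set.Iio r).indicator φ t * g r := by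
      intro r
      rw [lintegral_mul_const _ (hφ.indicator measurableSet_Iio),
        lintegral_indicator measurableSet_Iio, Measure.restrict_restrict measurableSet_Iio,
        Set.inter_comm, Set.Ioi_inter_Iio]
    have hmeas : Measurable fun p : ℝ × ℝ => (Set.Iio p.1).indicator φ p.2 * g p.1 := by
      have : (fun p : ℝ × ℝ => (Set.Iio p.1).indicator φ p.2)
          = {p : ℝ × ℝ | p.2 < p.1}.indicator fun p => φ p.2 := by
        ext p; simp [Set.indicator_apply]
      exact Measurable.mul (this ▸ (hφ.comp measurable_snd).indicator
        (measurableSet_lt measurable_snd measurable_fst)) (hgm.comp measurable_fst)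
    simp_rw [h1]
    rw [lintegral_lintegral_swap hmeas.aemeasurable]
    refine setLIntegral_congr_fun measurableSet_Ioi fun t (ht : 0 < t) => ?_
    have h2 : ∀ r, (Set.Iio r).indicator φ t * g r
        = (Set.Ioi t).indicator (fun r => φ t * g r) r := by
      intro r
      by_cases h : t < r <;> simp [h]
    simp_rw [h2]
    rw [lintegral_indicator measurableSet_Ioi, Measure.restrict_restrict measurableSet_Ioi,
      Set.Ioi_inter_Ioi, sup_of_le_left ht.le, ← lintegral_indicator measurableSet_Ioi,
      ← lintegral_indicator measurableSet_Ioi, ← lintegral_add_right_eq_self _ t]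
    refine lintegral_congr fun s => ?_
    by_cases h : 0 < s <;> simp [h]
  rw [hswap, ← lintegral_const_mul'' _ (by fun_prop), mul_comm (∫⁻ r in Set.Ioi 0, g r),
    ← lintegral_mul_const _ (by fun_prop)]
  refine setLIntegral_mono (by fun_prop) fun t (ht : 0 < t) => ?_
  rw [← lintegral_const_mul _ (by fun_prop), ← lintegral_const_mul _ (by fun_prop)]
  refine setLIntegral_mono (by fun_prop) fun s (hs : 0 < s) => ?_
  have := hg 0 s t hs.le ht.le
  calc g 0 * (φ t * g (0 + s + t)) = φ t * (g 0 * g (0 + s + t)) := by ring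
    _ ≤ φ t * (g (0 + s) * g (0 + t)) := by gcongr
    _ = _ := by simp only [zero_add]; ring

section Tail

variable {f : ℝ → ℝ≥0∞} {μ : Measure ℝ}

theorem setLIntegral_Ioi_mul_eq_ofReal_setIntegral (hfm : Measurable f) (hμ : μ = volume.withDensity f)
    {ψ : ℝ → ℝ} (hψ : Measurable ψ) (hψ0 : ∀ r, 0 < r → 0 ≤ ψ r) (hint : Integrable ψ μ) :
    ∫⁻ r in Set.Ioi 0, ENNReal.ofReal (ψ r) * f r = ENNReal.ofReal (∫ r in Set.Ioi 0, ψ r ∂μ) := by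
  rw [ofReal_integral_eq_lintegral_ofReal hint.integrableOn
    ((ae_restrict_iff' measurableSet_Ioi).2 (ae_of_all _ hψ0)), hμ,
    setLIntegral_withDensity_eq_setLIntegral_mul _ hfm (by fun_prop) measurableSet_Ioi]
  simp [mul_comm]

theorem IsPF2.tail_bounds [IsProbabilityMeasure μ] (hf : IsPF2 f) (hfm : Measurable f)
    (hμ : μ = volume.withDensity f) (h2 : MemLp id 2 μ) {m : ℝ} (hm0 : 0 ≤ m)
    (hm : ENNReal.ofReal m ≤ f 0) :
    m * (∫ r in Set.Ioi 0, r ∂μ) ≤ μ.real (Set.Ioi 0) ^ 2 ∧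
    m * (∫ r in Set.Ioi 0, r ^ 2 ∂μ) ≤ 2 * (μ.real (Set.Ioi 0) * ∫ r in Set.Ioi 0, r ∂μ) := by
  have hint1 : Integrable (fun r : ℝ => r) μ := h2.integrable (by norm_num)
  have hint2 : Integrable (fun r : ℝ => r ^ 2) μ := h2.integrable_sq
  have hq : ∫⁻ r in Set.Ioi 0, f r = ENNReal.ofReal (μ.real (Set.Ioi 0)) := by
    rw [ofReal_measureReal, hμ, withDensity_apply _ measurableSet_Ioi]
  have hH := setLIntegral_Ioi_mul_eq_ofReal_setIntegral hfm hμ (ψ := fun r => r) (by fun_prop)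
    (fun r hr => hr.le) hint1
  have hK := setLIntegral_Ioi_mul_eq_ofReal_setIntegral hfm hμ (ψ := fun r => r ^ 2 / 2) (by fun_prop)
    (fun r hr => by positivity) (hint2.div_const 2)
  have hH0 : 0 ≤ ∫ r in Set.Ioi 0, r ∂μ := setIntegral_nonneg measurableSet_Ioi
    fun r hr => le_of_lt hr
  have t1 := hf.apply_zero_mul_lintegral_le hfm (φ := fun _ => 1) (by fun_prop)
  have t2 := hf.apply_zero_mul_lintegral_le hfm (φ := fun t => ENNReal.ofReal t) (by fun_prop)
  have e1 : ∀ r : ℝ, ∫⁻ t in Set.Ioo 0 r, (1 : ℝ≥0∞) = ENNReal.ofReal r := by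
    intro r; simp
  have e2 : ∀ r : ℝ, 0 < r → ∫⁻ t in Set.Ioo 0 r, ENNReal.ofReal t = ENNReal.ofReal (r ^ 2 / 2) := by
    intro r hr
    rw [← ofReal_integral_eq_lintegral_ofReal]
    · rw [← integral_Ioc_eq_integral_Ioo, ← intervalIntegral.integral_of_le hr.le, integral_id]
      simp
    · exact (continuous_id.integrableOn_Icc).mono_set Set.Ioo_subset_Icc_self
    · exact (ae_restrict_iff' measurableSet_Ioo).2 (ae_of_all _ fun t ht => ht.1.le)
  have e3 : ∫⁻ r in Set.Ioi (0 : ℝ), (∫⁻ t in Set.Ioo 0 r, ENNReal.ofReal t) * f r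
      = ∫⁻ r in Set.Ioi (0 : ℝ), ENNReal.ofReal (r ^ 2 / 2) * f r :=
    setLIntegral_congr_fun measurableSet_Ioi fun r hr => by simp only [e2 r hr]
  simp only [e1, one_mul] at t1
  rw [hH, hq] at t1
  rw [e3, hH, hK, hq] at t2
  constructor
  · have := (mul_le_mul_left hm _).trans t1
    rw [← ENNReal.ofReal_mul hm0, ← ENNReal.ofReal_mul (by positivity),
      ENNReal.ofReal_le_ofReal_iff (by positivity)] at this
    linarith
  · have := (mul_le_mul_left hm _).trans t2
    rw [← ENNReal.ofReal_mul hm0, ← ENNReal.ofReal_mul (by positivity),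
      ENNReal.ofReal_le_ofReal_iff (by positivity), integral_div] at this
    linarith

end Tail

theorem variance_poly_bound {m q q' H H' K K' : ℝ} (hm : 0 < m) (hq : 0 ≤ q) (hq' : 0 ≤ q')
    (hqq : q + q' ≤ 1) (hH0 : 0 ≤ H) (hH0' : 0 ≤ H')
    (hH : m * H ≤ q ^ 2) (hK : m * K ≤ 2 * (q * H))
    (hH' : m * H' ≤ q' ^ 2) (hK' : m * K' ≤ 2 * (q' * H')) :
    m ^ 2 * (K + K' - (H - H') ^ 2) ≤ 1 := by
  set x := m * H with hx
  set y := m * H' with hy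
  have hx0 : 0 ≤ x := by positivity
  have hy0 : 0 ≤ y := by positivity
  have h1 : m ^ 2 * K ≤ 2 * (q * x) := by
    calc m ^ 2 * K = m * (m * K) := by ring
      _ ≤ m * (2 * (q * H)) := by gcongr
      _ = _ := by rw [hx]; ring
  have h2 : m ^ 2 * K' ≤ 2 * (q' * y) := by
    calc m ^ 2 * K' = m * (m * K') := by ring
      _ ≤ m * (2 * (q' * H')) := by gcongr
      _ = _ := by rw [hy]; ring
  have h3 : m ^ 2 * (K + K' - (H - H') ^ 2) ≤ 2 * q * x + 2 * q' * y - (x - y) ^ 2 := by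
    rw [hx, hy] at *
    nlinarith
  have h4 : 2 * q * x + 2 * q' * y - (x - y) ^ 2
      ≤ 2 * q * q ^ 2 + 2 * q' * y - (q ^ 2 - y) ^ 2 := by
    nlinarith [mul_nonneg (sub_nonneg.2 hH) (by nlinarith : 0 ≤ 2 * q - x - q ^ 2 + 2 * y)]
  have h5 : 2 * q * q ^ 2 + 2 * q' * y - (q ^ 2 - y) ^ 2
      ≤ 2 * q * q ^ 2 + 2 * q' * q' ^ 2 - (q ^ 2 - q' ^ 2) ^ 2 := by
    nlinarith [mul_nonneg (sub_nonneg.2 hH') (by nlinarith : 0 ≤ 2 * q' - y - q' ^ 2 + 2 * q ^ 2)]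
  have h6 : q ^ 2 + q' ^ 2 ≤ 1 := by nlinarith
  have h7 : 2 * q * q ^ 2 + 2 * q' * q' ^ 2 - (q ^ 2 - q' ^ 2) ^ 2 ≤ q ^ 2 + q' ^ 2 := by
    have : 0 ≤ 1 - (q + q') := by linarith
    have e : q ^ 2 + q' ^ 2 - (2 * q * q ^ 2 + 2 * q' * q' ^ 2 - (q ^ 2 - q' ^ 2) ^ 2)
      = (q - q') ^ 2 * ((1 - (q + q')) ^ 2) + (2 * q * q') * (1 - (q + q')) := by ring
    nlinarith [mul_nonneg (sq_nonneg (q - q')) (sq_nonneg (1 - (q + q'))),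
      mul_nonneg (mul_nonneg hq hq') this]
  linarith

theorem setIntegral_Ioi_map_neg {μ : Measure ℝ} {ψ : ℝ → ℝ} (hψ : Measurable ψ) :
    ∫ r in Set.Ioi 0, ψ r ∂(μ.map fun x => -x) = ∫ r in Set.Iio 0, ψ (-r) ∂μ := by
  rw [setIntegral_map measurableSet_Ioi (by fun_prop) (by fun_prop)]
  simp

theorem IsPF2.sq_mul_variance_le_one_of_le_apply_zero {f : ℝ → ℝ≥0∞} {μ : Measure ℝ}
    [IsProbabilityMeasure μ] (hf : IsPF2 f)
    (hfm : Measurable f) (hμ : μ = volume.withDensity f) (h2 : MemLp id 2 μ) {m : ℝ} (hm0 : 0 < m)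
    (hm : ENNReal.ofReal m ≤ f 0) : m ^ 2 * Var[id; μ] ≤ 1 := by
  have hint1 : Integrable (fun r : ℝ => r) μ := h2.integrable (by norm_num)
  have hint2 : Integrable (fun r : ℝ => r ^ 2) μ := h2.integrable_sq
  have hμ' : μ.map (fun x => -x) = volume.withDensity fun x => f (-x) := by
    have h := withDensity_map_equiv (MeasurableEquiv.neg ℝ) volume f
    have h1 : (MeasurableEquiv.neg ℝ : ℝ → ℝ) = fun x => -x := rfl
    rw [MeasurableEquiv.symm_neg, h1, ← hμ, Measure.map_neg_eq_self (volume : Measure ℝ)] at h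
    exact h
  have hf' : IsPF2 fun x => f (-x) := by
    intro x s t hs ht
    dsimp only
    rw [mul_comm]
    exact hf.mul_le_mul (by linarith) (by linarith) (by ring)
  have : IsProbabilityMeasure (μ.map fun x => -x) :=
    Measure.isProbabilityMeasure_map (by fun_prop)
  have h2' : MemLp id 2 (μ.map fun x => -x) := by
    rw [memLp_map_measure_iff (by fun_prop) (by fun_prop)]
    exact h2.neg
  obtain ⟨a1, a2⟩ := hf.tail_bounds hfm hμ h2 hm0.le hm
  obtain ⟨b1, b2⟩ := hf'.tail_bounds (by fun_prop) hμ' h2' hm0.le (by simpa using hm)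
  rw [setIntegral_Ioi_map_neg (ψ := fun r => r) (by fun_prop)] at b1 b2
  rw [setIntegral_Ioi_map_neg (ψ := fun r => r ^ 2) (by fun_prop)] at b2
  have hq' : (μ.map fun x => -x).real (Set.Ioi 0) = μ.real (Set.Iio 0) := by
    rw [map_measureReal_apply (by fun_prop) measurableSet_Ioi]
    simp
  rw [hq'] at b1 b2
  have hsplit : ∀ ψ : ℝ → ℝ, ψ 0 = 0 → Integrable ψ μ →
      ∫ r, ψ r ∂μ = (∫ r in Set.Ioi 0, ψ r ∂μ) + ∫ r in Set.Iio 0, ψ r ∂μ := by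
    intro ψ h0 hψ
    rw [← integral_add_compl (measurableSet_Ioi (a := (0 : ℝ))) hψ, Set.compl_Ioi]
    congr 1
    refine setIntegral_eq_of_subset_of_forall_sdiff_eq_zero measurableSet_Iic
      Set.Iio_subset_Iic_self fun r hr => ?_
    have : r = 0 := le_antisymm hr.1 (not_lt.1 hr.2)
    rw [this, h0]
  have key := variance_poly_bound hm0 (q := μ.real (Set.Ioi 0)) (q' := μ.real (Set.Iio 0))
    (H := ∫ r in Set.Ioi 0, r ∂μ) (H' := ∫ r in Set.Iio 0, -r ∂μ)
    (K := ∫ r in Set.Ioi 0, r ^ 2 ∂μ) (K' := ∫ r in Set.Iio 0, (-r) ^ 2 ∂μ)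
    measureReal_nonneg measureReal_nonneg ?_ ?_ ?_ a1 a2 b1 b2
  · rw [variance_eq_sub h2]
    simp only [Pi.pow_apply, id]
    rw [hsplit (fun r => r) rfl hint1, hsplit (fun r => r ^ 2) (by simp) hint2]
    have hneg : ∫ r in Set.Iio 0, -r ∂μ = -∫ r in Set.Iio 0, r ∂μ := integral_neg _
    simp only [neg_sq, hneg, sub_neg_eq_add] at key
    exact key
  · rw [← measureReal_union (Set.disjoint_left.2 fun x (h : x ∈ Set.Ioi (0 : ℝ)) h' =>
      lt_asymm (Set.mem_Ioi.1 h) (Set.mem_Iio.1 h')) measurableSet_Iio]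
    exact measureReal_le_one
  · exact setIntegral_nonneg measurableSet_Ioi fun r hr => le_of_lt hr
  · exact setIntegral_nonneg measurableSet_Iio fun r (hr : r < 0) => by linarith

/-- A log-concave probability density on the line with variance `σ²` is bounded by `1 / σ`. -/
theorem IsPF2.le_inv_of_variance_eq {f : ℝ → ℝ≥0∞} {μ : Measure ℝ} [IsProbabilityMeasure μ]
    (hf : IsPF2 f) (hfm : Measurable f) (hμ : μ = volume.withDensity f) (h2 : MemLp id 2 μ) {σ : ℝ}
    (hσ : 0 < σ) (hvar : Var[id; μ] = σ ^ 2) (x : ℝ) : f x ≤ ENNReal.ofReal σ⁻¹ := by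
  have hf' : IsPF2 fun y => f (y + x) := by
    intro y s t hs ht
    dsimp only
    exact hf.mul_le_mul (by linarith) (by linarith) (by ring)
  have hμ' : μ.map (fun y => y - x) = volume.withDensity fun y => f (y + x) := by
    have h := withDensity_map_equiv (MeasurableEquiv.subRight x) volume f
    have h1 : (MeasurableEquiv.subRight x : ℝ → ℝ) = fun y => y - x := rfl
    rw [h1, ← hμ, map_sub_right_eq_self (volume : Measure ℝ)] at h
    exact h
  have : IsProbabilityMeasure (μ.map fun y => y - x) :=
    Measure.isProbabilityMeasure_map (by fun_prop)
  have h2' : MemLp id 2 (μ.map fun y => y - x) := by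
    rw [memLp_map_measure_iff (by fun_prop) (by fun_prop)]
    exact h2.sub (memLp_const x)
  have hvar' : Var[id; μ.map fun y => y - x] = σ ^ 2 := by
    rw [variance_map (by fun_prop) (by fun_prop), ← hvar]
    exact variance_sub_const (by fun_prop) x
  by_contra! hlt
  obtain ⟨m, hm1, hm2⟩ := ENNReal.lt_iff_exists_nnreal_btwn.1 hlt
  have hm1' : σ⁻¹ < m := by
    rwa [← ENNReal.ofReal_coe_nnreal, ENNReal.ofReal_lt_ofReal_iff_of_nonneg (by positivity)] at hm1
  have hm0 : (0 : ℝ) < m := lt_trans (by positivity) hm1'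
  have key := hf'.sq_mul_variance_le_one_of_le_apply_zero (by fun_prop) hμ' h2' hm0
    (by simpa using hm2.le)
  rw [hvar', ← mul_pow] at key
  have : 1 < (m : ℝ) * σ := by
    rw [inv_lt_iff_one_lt_mul₀ hσ] at hm1'
    linarith
  nlinarith

theorem memLp_id_expMeasure : MemLp id 2 (expMeasure 1) ∧ Var[id; expMeasure 1] = 1 := by
  have : IsProbabilityMeasure (expMeasure 1) := isProbabilityMeasure_expMeasure one_pos
  have hexp : expMeasure 1 = volume.withDensity fun x => exponentialPDF 1 x := rfl
  have htop : ∀ᵐ x : ℝ, exponentialPDF 1 x < ∞ := ae_of_all _ fun x => ENNReal.ofReal_lt_top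
  have hdens : ∀ (k : ℕ) (x : ℝ), x ^ k * (exponentialPDF 1 x).toReal
      = (Set.Ici 0).indicator (fun x => rexp (-x) * x ^ ((k + 1 : ℝ) - 1)) x := by
    intro k x
    rw [exponentialPDF_eq]
    by_cases h : 0 ≤ x
    · simp [h, (Real.exp_pos _).le, mul_comm]
    · simp [h]
  have hgi : ∀ k : ℕ, IntegrableOn (fun x : ℝ => rexp (-x) * x ^ ((k + 1 : ℝ) - 1)) (Set.Ici 0) := by
    intro k
    rw [integrableOn_Ici_iff_integrableOn_Ioi]
    exact Real.GammaIntegral_convergent (by positivity)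
  have hint : ∀ k : ℕ, Integrable (fun x : ℝ => x ^ k) (expMeasure 1) := by
    intro k
    rw [hexp, integrable_withDensity_iff measurable_exponentialPDF htop]
    simp_rw [hdens]
    exact (integrable_indicator_iff measurableSet_Ici).2 (hgi k)
  have hval : ∀ k : ℕ, ∫ x : ℝ, x ^ k ∂(expMeasure 1) = k.factorial := by
    intro k
    rw [hexp, integral_withDensity_eq_integral_toReal_smul measurable_exponentialPDF htop]
    simp_rw [smul_eq_mul, mul_comm (exponentialPDF 1 _).toReal, hdens]
    rw [integral_indicator measurableSet_Ici, integral_Ici_eq_integral_Ioi,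
      ← Real.Gamma_eq_integral (by positivity), Real.Gamma_nat_eq_factorial]
  have h2 : MemLp id 2 (expMeasure 1) :=
    (memLp_two_iff_integrable_sq (by fun_prop)).2 (hint 2)
  refine ⟨h2, ?_⟩
  have h1 := hval 1
  have h2' := hval 2
  simp only [pow_one] at h1
  rw [variance_eq_sub h2]
  simp only [Pi.pow_apply, id]
  rw [h1, h2']
  norm_num

theorem scaledExpPDF_of_pos {a : ℝ} (ha : 0 < a) (x : ℝ) :
    scaledExpPDF a x
      = (Set.Ici 0).indicator (fun x => ENNReal.ofReal (a⁻¹ * rexp (-(x / a)))) x := by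
  rw [scaledExpPDF, abs_of_pos (by positivity), exponentialPDF_eq, Set.indicator_apply]
  by_cases h : 0 ≤ x
  · rw [if_pos (by positivity), if_pos (Set.mem_Ici.2 h), ← ENNReal.ofReal_mul (by positivity)]
    congr 3
    field_simp
  · have : ¬ 0 ≤ a⁻¹ * x := by
      rw [not_le] at h ⊢
      exact mul_neg_of_pos_of_neg (by positivity) h
    simp [h, this]

theorem scaledExpPDF_neg (a x : ℝ) : scaledExpPDF (-a) x = scaledExpPDF a (-x) := by
  simp [scaledExpPDF, inv_neg]

/-- The density of the asymmetric Laplace variable `u * X - v * X'` at `y` is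
`(u + v)⁻¹ * exp (-max (y / u) (-(y / v)))`; only the upper bound is recorded. -/
theorem lconvolution_scaledExpPDF_le {u v : ℝ} (hu : 0 < u) (hv : 0 < v) (y : ℝ) :
    (scaledExpPDF u ⋆ₗ scaledExpPDF (-v)) y
      ≤ ENNReal.ofReal ((u + v)⁻¹ * rexp (-max (y / u) (-(y / v)))) := by
  set M := max 0 y
  have hc : 0 < u⁻¹ + v⁻¹ := by positivity
  have hpt : ∀ z, scaledExpPDF u z * scaledExpPDF (-v) (-z + y)
      = (Set.Ici M).indicator (fun z => ENNReal.ofReal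
          (u⁻¹ * v⁻¹ * rexp (y / v) * rexp (-(u⁻¹ + v⁻¹) * z))) z := by
    intro z
    rw [scaledExpPDF_neg, scaledExpPDF_of_pos hu, scaledExpPDF_of_pos hv]
    by_cases h1 : 0 ≤ z
    · by_cases h2 : y ≤ z
      · rw [Set.indicator_of_mem (Set.mem_Ici.2 h1),
          Set.indicator_of_mem (Set.mem_Ici.2 (by linarith)),
          Set.indicator_of_mem (Set.mem_Ici.2 (max_le h1 h2)),
          ← ENNReal.ofReal_mul (by positivity), mul_mul_mul_comm, ← Real.exp_add, mul_assoc (u⁻¹ * v⁻¹),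
          ← Real.exp_add]
        congr 3
        field_simp
        ring
      · rw [Set.indicator_of_notMem (a := -(-z + y)) (by simpa using h2),
          Set.indicator_of_notMem (s := Set.Ici M) (by simp [M, h2]), mul_zero]
    · rw [Set.indicator_of_notMem (a := z) (by simpa using h1),
          Set.indicator_of_notMem (s := Set.Ici M) (by simp [M, h1]), zero_mul]
  rw [lconvolution_def]
  simp_rw [hpt]
  have hint : IntegrableOn (fun z => u⁻¹ * v⁻¹ * rexp (y / v) * rexp (-(u⁻¹ + v⁻¹) * z))
      (Set.Ioi M) := (integrableOn_exp_mul_Ioi (by linarith) M).const_mul _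
  rw [lintegral_indicator measurableSet_Ici, setLIntegral_congr Ioi_ae_eq_Ici.symm,
    ← ofReal_integral_eq_lintegral_ofReal hint (ae_of_all _ fun z => by positivity),
    integral_const_mul, integral_exp_mul_Ioi (by linarith)]
  refine ENNReal.ofReal_le_ofReal (le_of_eq ?_)
  have he : y / v + -(u⁻¹ + v⁻¹) * M = -max (y / u) (-(y / v)) := by
    rcases le_total 0 y with h | h
    · have h3 : -(y / v) ≤ y / u := (neg_nonpos.2 (by positivity)).trans (by positivity)
      rw [max_eq_left h3, show M = y from max_eq_right h]
      field_simp
      ring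
    · have h3 : y / u ≤ -(y / v) :=
        (div_nonpos_of_nonpos_of_nonneg h hu.le).trans
          (neg_nonneg.2 (div_nonpos_of_nonpos_of_nonneg h hv.le))
      rw [max_eq_right h3, show M = 0 from max_eq_left h]
      ring
  rw [← he, Real.exp_add]
  field_simp
  ring

/-- The bathtub principle, in the form of a bound through the excess over a level `τ`. -/
theorem lintegral_mul_le_add_mul_lintegral_sub {α : Type*} [MeasurableSpace α] {μ : Measure α}
    {f h : α → ℝ≥0∞} {C τ : ℝ≥0∞} (hfm : Measurable f) (hhm : Measurable h) (hf : ∀ x, f x ≤ C)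
    (hf1 : ∫⁻ x, f x ∂μ = 1) :
    ∫⁻ x, f x * h x ∂μ ≤ τ + C * ∫⁻ x, (h x - τ) ∂μ := by
  calc ∫⁻ x, f x * h x ∂μ ≤ ∫⁻ x, (f x * τ + C * (h x - τ)) ∂μ := by
        refine lintegral_mono fun x => ?_
        calc f x * h x ≤ f x * (τ + (h x - τ)) := by gcongr; exact le_add_tsub
          _ = f x * τ + f x * (h x - τ) := mul_add _ _ _
          _ ≤ _ := by gcongr; exact hf x
    _ = _ := by
        rw [lintegral_add_left (by fun_prop), lintegral_mul_const _ hfm, hf1, one_mul,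
          lintegral_const_mul _ (by fun_prop)]

theorem lintegral_Ioi_exp_sub_le {k s c : ℝ} (hk : 0 < k) (hs : 0 < s) (hc : 0 ≤ c) :
    ∫⁻ z in Set.Ioi 0, ENNReal.ofReal (s⁻¹ * rexp (-(z / k)) - s⁻¹ * rexp (-c))
      ≤ ENNReal.ofReal (s⁻¹ * k * (1 - rexp (-c) - c * rexp (-c))) := by
  have hkc : 0 ≤ k * c := by positivity
  have hsplit : ∫⁻ z in Set.Ioi 0, ENNReal.ofReal (s⁻¹ * rexp (-(z / k)) - s⁻¹ * rexp (-c))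
      = ∫⁻ z in Set.Ioc 0 (k * c), ENNReal.ofReal (s⁻¹ * rexp (-(z / k)) - s⁻¹ * rexp (-c)) := by
    rw [← Set.Ioc_union_Ioi_eq_Ioi hkc, lintegral_union measurableSet_Ioi
      (Set.Ioc_disjoint_Ioi le_rfl), setLIntegral_eq_zero measurableSet_Ioi, add_zero]
    intro z (hz : k * c < z)
    refine ENNReal.ofReal_of_nonpos (sub_nonpos.2 ?_)
    have : c ≤ z / k := by rw [le_div_iff₀ hk]; linarith
    gcongr
  rw [hsplit, ← ofReal_integral_eq_lintegral_ofReal]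
  · refine ENNReal.ofReal_le_ofReal (le_of_eq ?_)
    rw [← intervalIntegral.integral_of_le hkc, intervalIntegral.integral_sub
      (Continuous.intervalIntegrable (by fun_prop) _ _) (by simp),
      intervalIntegral.integral_const_mul]
    have h1 : ∫ z in (0 : ℝ)..(k * c), rexp (-(z / k)) = k * (1 - rexp (-c)) := by
      rw [intervalIntegral.integral_eq_sub_of_hasDerivAt (f := fun z => -k * rexp (-(z / k)))]
      · rw [mul_div_cancel_left₀ _ hk.ne']
        simp
        ring
      · intro z _
        refine HasDerivAt.congr_deriv (f' := -k * (rexp (-(z / k)) * -(1 / k))) ?_ (by field_simp)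
        exact ((hasDerivAt_id z).div_const k).neg.exp.const_mul (-k)
      · exact Continuous.intervalIntegrable (by fun_prop) _ _
    rw [h1]
    simp
    ring
  · exact (Continuous.integrableOn_Icc (by fun_prop)).mono_set Set.Ioc_subset_Icc_self
  · refine (ae_restrict_iff' measurableSet_Ioc).2 (ae_of_all _ fun z hz => ?_)
    have : z / k ≤ c := by rw [div_le_iff₀ hk]; linarith [hz.2]
    simp only [Pi.zero_apply, sub_nonneg]
    gcongr

theorem lintegral_eq_Ioi_add_Ioi_neg (g : ℝ → ℝ≥0∞) :
    ∫⁻ z, g z = (∫⁻ z in Set.Ioi 0, g z) + ∫⁻ z in Set.Ioi 0, g (-z) := by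
  rw [← lintegral_add_compl g (measurableSet_Ioi (a := (0 : ℝ))), Set.compl_Ioi,
    setLIntegral_congr Iio_ae_eq_Iic.symm]
  congr 1
  rw [← lintegral_indicator measurableSet_Iio, ← lintegral_indicator measurableSet_Ioi,
    ← lintegral_neg_eq_self]
  refine lintegral_congr fun z => ?_
  simp [Set.indicator_apply]

theorem lintegral_laplace_sub_le {u v c : ℝ} (hu : 0 < u) (hv : 0 < v) (hc : 0 ≤ c) :
    ∫⁻ z, (ENNReal.ofReal ((u + v)⁻¹ * rexp (-max (z / u) (-(z / v))))
        - ENNReal.ofReal ((u + v)⁻¹ * rexp (-c)))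
      ≤ ENNReal.ofReal (1 - rexp (-c) - c * rexp (-c)) := by
  simp_rw [← ENNReal.ofReal_sub _ (show 0 ≤ (u + v)⁻¹ * rexp (-c) by positivity)]
  have hpos : 0 ≤ 1 - rexp (-c) - c * rexp (-c) := by
    have h1 := Real.add_one_le_exp c
    have h2 : rexp c * rexp (-c) = 1 := by rw [← Real.exp_add]; simp
    nlinarith [Real.exp_pos (-c)]
  rw [lintegral_eq_Ioi_add_Ioi_neg]
  have h1 : ∫⁻ z in Set.Ioi 0, ENNReal.ofReal ((u + v)⁻¹ * rexp (-max (z / u) (-(z / v)))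
      - (u + v)⁻¹ * rexp (-c)) ≤ _ := le_trans (setLIntegral_mono (by fun_prop) fun z (hz : 0 < z) => by
        gcongr; exact le_max_left _ _) (lintegral_Ioi_exp_sub_le hu (add_pos hu hv) hc)
  have h2 : ∫⁻ z in Set.Ioi 0, ENNReal.ofReal ((u + v)⁻¹ * rexp (-max (-z / u) (-(-z / v)))
      - (u + v)⁻¹ * rexp (-c)) ≤ _ := le_trans (setLIntegral_mono (by fun_prop) fun z (hz : 0 < z) => by
        gcongr
        refine le_trans ?_ (le_max_right _ _)
        rw [neg_div, neg_neg]) (lintegral_Ioi_exp_sub_le hv (add_pos hu hv) hc)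
  refine (add_le_add h1 h2).trans (le_of_eq ?_)
  rw [← ENNReal.ofReal_add (by positivity) (by positivity), ← add_mul, ← mul_add,
    inv_mul_cancel₀ (by positivity), one_mul]

theorem lconvolution_laplace_le {f : ℝ → ℝ≥0∞} (hfm : Measurable f) (hf1 : ∫⁻ x, f x = 1)
    {u v σ : ℝ} (hu : 0 < u) (hv : 0 < v) (hσ : 0 < σ) (hf : ∀ x, f x ≤ ENNReal.ofReal σ⁻¹)
    (y : ℝ) : (f ⋆ₗ (scaledExpPDF u ⋆ₗ scaledExpPDF (-v))) y
      ≤ ENNReal.ofReal (σ⁻¹ * (1 - rexp (-(σ / (u + v))))) := by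
  set c := σ / (u + v)
  have hc : 0 ≤ c := by positivity
  set h := scaledExpPDF u ⋆ₗ scaledExpPDF (-v)
  have hhm : Measurable h :=
    measurable_lconvolution _ (measurable_scaledExpPDF _) (measurable_scaledExpPDF _)
  rw [lconvolution_def]
  refine (lintegral_mul_le_add_mul_lintegral_sub (τ := ENNReal.ofReal ((u + v)⁻¹ * rexp (-c)))
    hfm (by fun_prop) hf hf1).trans ?_
  have hexcess : ∫⁻ z, (h (-z + y) - ENNReal.ofReal ((u + v)⁻¹ * rexp (-c)))
      ≤ ENNReal.ofReal (1 - rexp (-c) - c * rexp (-c)) := by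
    rw [← lintegral_neg_eq_self]
    simp only [neg_neg]
    rw [lintegral_add_right_eq_self (fun z => h z - ENNReal.ofReal ((u + v)⁻¹ * rexp (-c))) y]
    refine le_trans (lintegral_mono fun z => ?_) (lintegral_laplace_sub_le hu hv hc)
    exact tsub_le_tsub_right (lconvolution_scaledExpPDF_le hu hv z) _
  have hpos : 0 ≤ 1 - rexp (-c) - c * rexp (-c) := by
    have h1 := Real.add_one_le_exp c
    have h2 : rexp c * rexp (-c) = 1 := by rw [← Real.exp_add]; simp
    nlinarith [Real.exp_pos (-c)]
  refine (add_le_add_right (mul_le_mul_right hexcess _) _).trans (le_of_eq ?_)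
  rw [← ENNReal.ofReal_mul (by positivity), ← ENNReal.ofReal_add (by positivity) (by positivity)]
  congr 1
  have : (u + v)⁻¹ = σ⁻¹ * c := by simp only [c]; field_simp
  rw [this]
  ring

section Sum

variable {ι : Type*} [Fintype ι] (a : ι → ℝ)

theorem iIndepFun_mul_expMeasure :
    iIndepFun (fun i (x : ι → ℝ) => a i * x i) (Measure.pi fun _ => expMeasure 1) := by
  have : IsProbabilityMeasure (expMeasure 1) := isProbabilityMeasure_expMeasure one_pos
  exact iIndepFun_pi (X := fun i x => a i * x) fun i => by fun_prop

theorem map_mul_pi_expMeasure {i : ι} (ha : a i ≠ 0) :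
    (Measure.pi fun _ => expMeasure 1).map (fun x : ι → ℝ => a i * x i)
      = volume.withDensity (scaledExpPDF (a i)) := by
  have : IsProbabilityMeasure (expMeasure 1) := isProbabilityMeasure_expMeasure one_pos
  have heval := measurePreserving_eval (fun _ : ι => expMeasure 1) i
  conv_rhs => rw [← map_mul_expMeasure ha, ← heval.map_eq]
  exact (Measure.map_map (measurable_const_mul (a i)) heval.measurable).symm

theorem variance_sum_mul_expMeasure (s : Finset ι) :
    MemLp (∑ j ∈ s, fun x : ι → ℝ => a j * x j) 2 (Measure.pi fun _ => expMeasure 1) ∧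
    Var[∑ j ∈ s, fun x : ι → ℝ => a j * x j; Measure.pi fun _ => expMeasure 1]
      = ∑ j ∈ s, a j ^ 2 := by
  have : IsProbabilityMeasure (expMeasure 1) := isProbabilityMeasure_expMeasure one_pos
  obtain ⟨h2, hvar⟩ := memLp_id_expMeasure
  have hev : ∀ i, MemLp (fun x : ι → ℝ => x i) 2 (Measure.pi fun _ => expMeasure 1) := fun i =>
    h2.comp_measurePreserving (measurePreserving_eval (fun _ : ι => expMeasure 1) i)
  have hmem : ∀ i, MemLp (fun x : ι → ℝ => a i * x i) 2 (Measure.pi fun _ => expMeasure 1) :=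
    fun i => (hev i).const_mul (a i)
  refine ⟨memLp_finsetSum' _ fun i _ => hmem i, ?_⟩
  rw [IndepFun.variance_sum (fun i _ => hmem i)
    fun i _ j _ hij => (iIndepFun_mul_expMeasure a).indepFun hij]
  refine Finset.sum_congr rfl fun i _ => ?_
  rw [variance_const_mul]
  have : Var[fun x : ι → ℝ => x i; Measure.pi fun _ => expMeasure 1] = 1 := by
    have heval := measurePreserving_eval (fun _ : ι => expMeasure 1) i
    have h := variance_map (μ := Measure.pi fun _ : ι => expMeasure 1) (X := id)
      (by fun_prop) heval.measurable.aemeasurable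
    rw [heval.map_eq, hvar] at h
    exact h.symm
  rw [this, mul_one]

variable [DecidableEq ι]

theorem map_sum_insert_eq_withDensity {s : Finset ι} {i : ι} (hi : i ∉ s) (ha : a i ≠ 0)
    {f : ℝ → ℝ≥0∞} (hfm : Measurable f)
    (hf : (Measure.pi fun _ => expMeasure 1).map (∑ j ∈ s, fun x : ι → ℝ => a j * x j)
      = volume.withDensity f) :
    (Measure.pi fun _ => expMeasure 1).map (∑ j ∈ insert i s, fun x : ι → ℝ => a j * x j)
      = volume.withDensity (f ⋆ₗ scaledExpPDF (a i)) := by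
  have : IsProbabilityMeasure (expMeasure 1) := isProbabilityMeasure_expMeasure one_pos
  have hind := (iIndepFun_mul_expMeasure a).indepFun_finsetSum_of_notMem
    (fun j => by fun_prop) hi
  rw [Finset.sum_insert hi, add_comm, hind.map_add_eq_map_conv_map (by fun_prop) (by fun_prop), hf,
    map_mul_pi_expMeasure a ha,
    conv_withDensity_eq_lconvolution hfm (measurable_scaledExpPDF _)]

theorem exists_isPF2_density {s : Finset ι} (hs : s.Nonempty) (ha : ∀ i ∈ s, a i ≠ 0) :
    ∃ f : ℝ → ℝ≥0∞, Measurable f ∧ IsPF2 f ∧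
      (Measure.pi fun _ => expMeasure 1).map (∑ j ∈ s, fun x : ι → ℝ => a j * x j)
        = volume.withDensity f := by
  induction hs using Finset.Nonempty.cons_induction with
  | singleton i =>
    refine ⟨scaledExpPDF (a i), measurable_scaledExpPDF _, isPF2_scaledExpPDF _, ?_⟩
    rw [Finset.sum_singleton, map_mul_pi_expMeasure a (ha i (by simp))]
  | cons i s hi hs ih =>
    obtain ⟨f, hfm, hf, hfs⟩ := ih fun j hj => ha j (by simp [hj])
    rw [Finset.cons_eq_insert]
    exact ⟨_, measurable_lconvolution _ hfm (measurable_scaledExpPDF _),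
      hf.lconvolution (isPF2_scaledExpPDF _) hfm (measurable_scaledExpPDF _),
      map_sum_insert_eq_withDensity a hi (ha i (by simp)) hfm hfs⟩

end Sum

theorem le_of_withDensity_ofReal_eq {p : ℝ → ℝ} (hp : Continuous p) {g : ℝ → ℝ≥0∞}
    (hgm : Measurable g) (hg1 : ∫⁻ x, g x ≠ ∞) {C : ℝ} (hC : 0 ≤ C)
    (hgC : ∀ x, g x ≤ ENNReal.ofReal C)
    (h : volume.withDensity g = volume.withDensity fun x => ENNReal.ofReal (p x)) (x : ℝ) :
    p x ≤ C := by
  have hae := (withDensity_eq_iff hgm.aemeasurable (by fun_prop) hg1).1 h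
  have hle : ∀ᵐ x, p x ≤ C := by
    filter_upwards [hae] with x hx
    exact (ENNReal.ofReal_le_ofReal_iff hC).1 (hx ▸ hgC x)
  have hopen : IsOpen {x | C < p x} := isOpen_lt continuous_const hp
  have hzero : volume {x | C < p x} = 0 := by
    simpa [ae_iff] using hle
  rw [hopen.measure_eq_zero_iff volume] at hzero
  by_contra! hlt
  exact (hzero ▸ (show x ∈ {x | C < p x} from hlt) : x ∈ (∅ : Set ℝ))

theorem pos_of_sum_eq_zero_of_forall_le {ι : Type*} [Fintype ι] {a : ι → ℝ} (hsum : ∑ j, a j = 0)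
    {i : ι} (hle : ∀ j, a j ≤ a i) {k : ι} (hne : a k ≠ 0) : 0 < a i := by
  by_contra! h
  have := (Finset.sum_eq_zero_iff_of_nonpos fun j _ => (hle j).trans h).1 hsum k (Finset.mem_univ k)
  exact hne this

/-- **Convolution bound in Case 1 of the stability proof.**
For `n ≥ 2` and a unit vector `a ∈ ℝ^{n+1}` with `∑ aⱼ = 0`, `a₁ ≥ ... ≥ a_{n+1}`, setting
`u = a₁`, `v = -a_{n+1}`, `σ = √(1 - u² - v²)` and assuming `σ > 0`, we have
`p_a(0) ≤ (1/σ)(1 - exp(-σ/(u+v)))`. -/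
theorem convolution_bound_simplex_sections (n : ℕ) (hn : 2 ≤ n)
    (a : EuclideanSpace ℝ (Fin (n + 1))) (hnorm : ‖a‖ = 1)
    (hsum : ∑ j, a j = 0) (hmono : ∀ i j : Fin (n + 1), i ≤ j → a j ≤ a i)
    (p : ℝ → ℝ) (hp : IsExpSumDensity (fun j => a j) p)
    (u v σ : ℝ) (hu : u = a 0) (hv : v = -(a (Fin.last n)))
    (hσ : σ = Real.sqrt (1 - u ^ 2 - v ^ 2)) (hσpos : 0 < σ) :
    p 0 ≤ σ⁻¹ * (1 - Real.exp (-(σ / (u + v)))) := by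
  have hprob : IsProbabilityMeasure (expMeasure 1) := isProbabilityMeasure_expMeasure one_pos
  have hnorm2 : ∑ j, a j ^ 2 = 1 := by
    have := EuclideanSpace.real_norm_sq_eq a
    rw [hnorm] at this
    simpa using this.symm
  obtain ⟨k, hk⟩ : ∃ k, a k ≠ 0 := by
    by_contra! h
    simp [h] at hnorm2
  have hu0 : 0 < a 0 :=
    pos_of_sum_eq_zero_of_forall_le hsum (fun j => hmono 0 j (Fin.zero_le j)) hk
  have hv0 : 0 < -a (Fin.last n) :=
    pos_of_sum_eq_zero_of_forall_le (a := fun j => -a j) (by simp [hsum])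
      (fun j => neg_le_neg (hmono j (Fin.last n) (Fin.le_last j))) (neg_ne_zero.2 hk)
  have hσ2 : σ ^ 2 = 1 - u ^ 2 - v ^ 2 := by
    rw [hσ, Real.sq_sqrt (Real.sqrt_pos.1 (hσ ▸ hσpos)).le]
  have h0last : (0 : Fin (n + 1)) ≠ Fin.last n := by
    intro h
    have := congrArg a h
    linarith
  set s : Finset (Fin (n + 1)) :=
    Finset.univ.filter fun j => a j ≠ 0 ∧ j ≠ 0 ∧ j ≠ Fin.last n with hs
  have h0s : (0 : Fin (n + 1)) ∉ s := by simp [hs]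
  have hlasts : Fin.last n ∉ insert 0 s := by simp [hs, h0last.symm]
  have hzero : ∀ j, j ∉ insert (Fin.last n) (insert 0 s) → a j = 0 := by
    intro j hj
    simp only [hs, Finset.mem_insert, Finset.mem_filter, Finset.mem_univ, true_and] at hj
    tauto
  have hvar : ∑ j ∈ s, a j ^ 2 = σ ^ 2 := by
    have h1 : ∑ j ∈ insert (Fin.last n) (insert 0 s), a j ^ 2 = 1 := by
      rw [← hnorm2]
      exact Finset.sum_subset (Finset.subset_univ _) fun j _ hj => by simp [hzero j hj]
    rw [Finset.sum_insert hlasts, Finset.sum_insert h0s] at h1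
    rw [hσ2, hu, hv]
    linarith
  have hsne : s.Nonempty := by
    by_contra! h
    rw [h, Finset.sum_empty] at hvar
    exact (pow_pos hσpos 2).ne hvar
  obtain ⟨f, hfm, hf, hfs⟩ := exists_isPF2_density (fun j => a j) hsne fun j hj =>
    (Finset.mem_filter.1 hj).2.1
  obtain ⟨hmem, hvarsum⟩ := variance_sum_mul_expMeasure (fun j => a j) s
  have hSm : Measurable (∑ j ∈ s, fun x : Fin (n + 1) → ℝ => a j * x j) := by fun_prop
  have hμ : IsProbabilityMeasure (volume.withDensity f) :=
    hfs ▸ Measure.isProbabilityMeasure_map hSm.aemeasurable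
  have hfbound : ∀ x, f x ≤ ENNReal.ofReal σ⁻¹ := by
    refine hf.le_inv_of_variance_eq hfm rfl ?_ hσpos ?_
    · rw [← hfs, memLp_map_measure_iff (by fun_prop) hSm.aemeasurable]
      exact hmem
    · rw [← hfs, variance_map (by fun_prop) hSm.aemeasurable, ← hvar, ← hvarsum]
      rfl
  have hf1 : ∫⁻ x, f x = 1 := by
    rw [← setLIntegral_univ, ← withDensity_apply _ MeasurableSet.univ]
    exact measure_univ
  have hS0 := map_sum_insert_eq_withDensity (fun j => a j) h0s hu0.ne' hfm hfs
  have hS := map_sum_insert_eq_withDensity (fun j => a j) hlasts (neg_pos.1 hv0).ne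
    (measurable_lconvolution _ hfm (measurable_scaledExpPDF _)) hS0
  have hsumfun : (∑ j ∈ insert (Fin.last n) (insert 0 s), fun x : Fin (n + 1) → ℝ => a j * x j)
      = fun x => ∑ j, a j * x j := by
    ext x
    rw [Finset.sum_apply]
    exact Finset.sum_subset (Finset.subset_univ _) fun j _ hj => by simp [hzero j hj]
  rw [hsumfun, ← lconvolution_assoc hfm (measurable_scaledExpPDF _) (measurable_scaledExpPDF _),
    show a (Fin.last n) = -v by rw [hv, neg_neg], ← hu] at hS
  have hgm : Measurable (f ⋆ₗ (scaledExpPDF u ⋆ₗ scaledExpPDF (-v))) :=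
    measurable_lconvolution _ hfm
      (measurable_lconvolution _ (measurable_scaledExpPDF _) (measurable_scaledExpPDF _))
  have hg1 : ∫⁻ x, (f ⋆ₗ (scaledExpPDF u ⋆ₗ scaledExpPDF (-v))) x ≠ ∞ := by
    rw [← setLIntegral_univ, ← withDensity_apply _ MeasurableSet.univ, ← hS]
    have := Measure.isProbabilityMeasure_map (μ := Measure.pi fun _ : Fin (n + 1) => expMeasure 1)
      (f := fun x => ∑ j, a j * x j) (Measurable.aemeasurable (hsumfun ▸ by fun_prop))
    exact measure_ne_top _ _
  rw [← hu] at hu0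
  rw [← hv] at hv0
  refine le_of_withDensity_ofReal_eq hp.1 hgm hg1 ?_
    (lconvolution_laplace_le hfm hf1 hu0 hv0 hσpos hfbound) (hS.symm.trans hp.2) 0
  refine mul_nonneg (by positivity) (sub_nonneg.2 (Real.exp_le_one_iff.2 ?_))
  exact neg_nonpos.2 (by positivity)
end

section
/- Define Ψ(x) = (√2/π) ∫_0^∞ (1 + x t²)^{−1/(2x)} dt for 0 < x < 1. Let n ≥ 2 and let a = (a_1, ..., a_{n+1}) be a unit vector in ℝ^{n+1} with Σ_j a_j = 0, all coordinates nonzero, and a_1 = max_j |a_j|. Set m = max_{j>1} |a_j|. Then √2 · p_a(0) ≤ Ψ(a_1²)^{a_1²} · Ψ(m²)^{1 − a_1²}. -/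
open MeasureTheory ProbabilityTheory Real

/-- `Ψ(x) = (√2/π) ∫₀^∞ (1 + x t²)^{-1/(2x)} dt`. -/
noncomputable def Psi (x : ℝ) : ℝ :=
  (Real.sqrt 2 / Real.pi) * ∫ t in Set.Ioi (0 : ℝ), (1 + x * t ^ 2) ^ (-(1 / (2 * x)))

/-- Fourier inversion bound: a continuous density of a finite measure is bounded by the `L¹` norm
of its characteristic function. -/
lemma ofReal_density_le_lintegral_charFun {p : ℝ → ℝ} (hp : Continuous p) {μ : Measure ℝ}
    [IsFiniteMeasure μ] (hμ : μ = volume.withDensity fun x => ENNReal.ofReal (p x)) (v : ℝ) :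
    ENNReal.ofReal (p v) ≤ ∫⁻ ξ : ℝ, ‖charFun μ (-(2 * π) * ξ)‖ₑ := by
  set q : ℝ → ℂ := fun x => ((max (p x) 0 : ℝ) : ℂ) with hq
  have hqc : Continuous q := by fun_prop
  have hqi : Integrable q := by
    refine ⟨hqc.aestronglyMeasurable, ?_⟩
    have h1 : ∫⁻ x, ‖q x‖ₑ = μ Set.univ := by
      rw [hμ, withDensity_apply _ MeasurableSet.univ, Measure.restrict_univ]
      refine lintegral_congr fun x => ?_
      rw [← ofReal_norm, hq, Complex.norm_real, Real.norm_of_nonneg (le_max_right _ _),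
        ENNReal.ofReal_max]
      simp
    rw [HasFiniteIntegral, h1]
    exact measure_lt_top _ _
  have hF : ∀ ξ : ℝ, FourierTransform.fourier q ξ = charFun μ (-(2 * π) * ξ) := by
    intro ξ
    rw [Real.fourier_real_eq_integral_exp_smul, charFun_apply_real, hμ,
      integral_withDensity_eq_integral_toReal_smul (by fun_prop) (by simp)]
    refine integral_congr_ae (.of_forall fun x => ?_)
    simp only [hq, ENNReal.toReal_ofReal', Complex.real_smul, smul_eq_mul]
    rw [mul_comm]
    congr 2
    push_cast
    ring
  have hFm : AEStronglyMeasurable (FourierTransform.fourier q) volume := by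
    rw [funext hF]
    exact (measurable_charFun.comp (measurable_const_mul _)).aestronglyMeasurable
  rcases eq_or_ne (∫⁻ ξ : ℝ, ‖charFun μ (-(2 * π) * ξ)‖ₑ) ⊤ with htop | htop
  · rw [htop]
    exact le_top
  have hFi : Integrable (FourierTransform.fourier q) := by
    refine ⟨hFm, ?_⟩
    simp_rw [HasFiniteIntegral, hF]
    exact htop.lt_top
  have hinv := hqi.fourierInv_fourier_eq hFi hqc.continuousAt (v := v)
  calc ENNReal.ofReal (p v) = ‖q v‖ₑ := by
        rw [← ofReal_norm, hq, Complex.norm_real, Real.norm_of_nonneg (le_max_right _ _),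
          ENNReal.ofReal_max]
        simp
    _ ≤ ∫⁻ ξ : ℝ, ‖FourierTransform.fourier q ξ‖ₑ := by
        rw [← hinv, Real.fourierInv_eq]
        refine (enorm_integral_le_lintegral_enorm _).trans (lintegral_mono fun ξ => ?_)
        rw [← ofReal_norm, Circle.norm_smul, ofReal_norm]
    _ = _ := by simp_rw [hF]

lemma charFun_expMeasure_one (t : ℝ) :
    charFun (expMeasure 1) t = 1 / (1 - t * Complex.I) := by
  have hm : expMeasure 1 = volume.withDensity (exponentialPDF 1) := rfl
  have hpdf : Measurable (exponentialPDF 1) := (measurable_exponentialPDFReal 1).ennreal_ofReal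
  rw [charFun_apply_real, hm,
    integral_withDensity_eq_integral_toReal_smul hpdf (by simp [exponentialPDF])]
  have h1 : ∀ x : ℝ, (exponentialPDF 1 x).toReal • Complex.exp (t * x * Complex.I) =
      (Set.Ici (0 : ℝ)).indicator (fun x : ℝ => Complex.exp ((-1 + t * Complex.I) * x)) x := by
    intro x
    rcases lt_or_ge x 0 with hx | hx
    · rw [exponentialPDF_of_neg hx, Set.indicator_of_notMem (by simpa using hx)]
      simp
    · rw [exponentialPDF_of_nonneg hx, Set.indicator_of_mem (by simpa using hx),
        ENNReal.toReal_ofReal (by positivity), Complex.real_smul]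
      push_cast
      rw [one_mul, ← Complex.exp_add]
      congr 1
      ring
  simp_rw [h1]
  rw [integral_indicator measurableSet_Ici, integral_Ici_eq_integral_Ioi,
    integral_exp_mul_complex_Ioi (by simp)]
  rw [show (-1 + t * Complex.I : ℂ) = -(1 - t * Complex.I) by ring, neg_div_neg_eq]
  simp

lemma norm_charFun_expMeasure_one (t : ℝ) :
    ‖charFun (expMeasure 1) t‖ = (1 + t ^ 2) ^ (-(1 / 2) : ℝ) := by
  have h : ‖(1 - t * Complex.I : ℂ)‖ = (1 + t ^ 2) ^ (1 / 2 : ℝ) := by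
    rw [← Real.sqrt_eq_rpow, Complex.norm_def, Complex.normSq_apply]
    congr 1
    simp
    ring
  rw [charFun_expMeasure_one, norm_div, norm_one, h, Real.rpow_neg (by positivity), one_div]

/-- The characteristic function of a linear combination of independent variables. -/
lemma charFun_map_sum_mul_pi {ι : Type*} [Fintype ι] (μ : ι → Measure ℝ)
    [∀ i, IsProbabilityMeasure (μ i)] (a : ι → ℝ) (t : ℝ) :
    charFun ((Measure.pi μ).map fun x => ∑ j, a j * x j) t = ∏ j, charFun (μ j) (t * a j) := by
  have hm : Measurable fun x : ι → ℝ => ∑ j, a j * x j := by fun_prop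
  rw [charFun_apply_real, integral_map hm.aemeasurable (by fun_prop)]
  simp_rw [charFun_apply_real]
  rw [← integral_fintype_prod_eq_prod]
  refine integral_congr_ae (.of_forall fun x => ?_)
  simp only [← Complex.exp_sum]
  congr 1
  push_cast
  rw [Finset.mul_sum, Finset.sum_mul]
  refine Finset.sum_congr rfl fun j _ => ?_
  ring

lemma integrable_one_add_mul_sq_rpow {x : ℝ} (h0 : 0 < x) (h1 : x < 1) :
    Integrable fun t : ℝ => (1 + x * t ^ 2) ^ (-(1 / (2 * x))) := by
  have h : (Module.finrank ℝ ℝ : ℝ) < 1 / x := by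
    rw [Module.finrank_self, Nat.cast_one, lt_div_iff₀ h0]
    linarith
  have := (integrable_rpow_neg_one_add_norm_sq (μ := volume) (E := ℝ) h).comp_mul_left'
    (Real.sqrt_pos.2 h0).ne'
  refine this.congr (.of_forall fun t => ?_)
  simp only [Real.norm_eq_abs, sq_abs, mul_pow, Real.sq_sqrt h0.le]
  congr 1
  field_simp

lemma Psi_nonneg {x : ℝ} (h0 : 0 ≤ x) : 0 ≤ Psi x :=
  mul_nonneg (by positivity) (integral_nonneg fun t => by positivity)

lemma Psi_mono {x y : ℝ} (h0 : 0 < x) (hxy : x ≤ y) (h1 : y < 1) : Psi x ≤ Psi y := by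
  have hy : 0 < y := h0.trans_le hxy
  refine mul_le_mul_of_nonneg_left (setIntegral_mono
    (integrable_one_add_mul_sq_rpow h0 (hxy.trans_lt h1)).integrableOn
    (integrable_one_add_mul_sq_rpow hy h1).integrableOn fun t => ?_) (by positivity)
  have hb : 1 + y * t ^ 2 ≤ (1 + x * t ^ 2) ^ (y / x) := by
    have := one_add_mul_self_le_rpow_one_add (s := x * t ^ 2)
      (by linarith [mul_nonneg h0.le (sq_nonneg t)]) ((one_le_div h0).2 hxy)
    rwa [← mul_assoc, div_mul_cancel₀ _ h0.ne'] at this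
  calc (1 + x * t ^ 2) ^ (-(1 / (2 * x)))
      = ((1 + x * t ^ 2) ^ (y / x)) ^ (-(1 / (2 * y))) := by
        rw [← Real.rpow_mul (by positivity)]
        congr 1
        field_simp
    _ ≤ _ := Real.rpow_le_rpow_of_nonpos (by positivity) hb
        (neg_nonpos.2 (by positivity))

lemma lintegral_one_add_mul_sq_rpow {x : ℝ} (h0 : 0 < x) (h1 : x < 1) :
    ∫⁻ ξ : ℝ, ENNReal.ofReal ((1 + x * (-(2 * π) * ξ) ^ 2) ^ (-(1 / (2 * x)))) =
      ENNReal.ofReal (Psi x / √2) := by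
  have hi := (integrable_one_add_mul_sq_rpow h0 h1).comp_mul_left' (R := -(2 * π))
    (neg_ne_zero.2 (by positivity))
  rw [← ofReal_integral_eq_lintegral_ofReal hi (.of_forall fun ξ => by positivity)]
  congr 1
  have h := integral_comp_abs (f := fun t : ℝ => (1 + x * t ^ 2) ^ (-(1 / (2 * x))))
  simp only [sq_abs] at h
  rw [Measure.integral_comp_mul_left (fun t : ℝ => (1 + x * t ^ 2) ^ (-(1 / (2 * x)))), h, Psi,
    smul_eq_mul, inv_neg, abs_neg, abs_of_pos (by positivity)]
  field_simp

/-- Hölder's inequality applied to the Fourier inversion formula. -/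
lemma sqrt_two_mul_density_le_prod_Psi {k : ℕ} {a : Fin k → ℝ} (ha : ∑ j, a j ^ 2 = 1)
    (h0 : ∀ j, 0 < a j ^ 2) (h1 : ∀ j, a j ^ 2 < 1) {p : ℝ → ℝ} (hp : IsExpSumDensity a p)
    (v : ℝ) : √2 * p v ≤ ∏ j, Psi (a j ^ 2) ^ (a j ^ 2) := by
  have : IsProbabilityMeasure (expMeasure 1) := isProbabilityMeasure_expMeasure one_pos
  have hΨ : ∀ j, 0 ≤ Psi (a j ^ 2) := fun j => Psi_nonneg (h0 j).le
  have key : ENNReal.ofReal (p v) ≤ ∏ j, ENNReal.ofReal (Psi (a j ^ 2) / √2) ^ (a j ^ 2) := by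
    calc ENNReal.ofReal (p v) ≤ _ := ofReal_density_le_lintegral_charFun hp.1 hp.2 v
      _ = ∫⁻ ξ : ℝ, ∏ j, ENNReal.ofReal
            ((1 + a j ^ 2 * (-(2 * π) * ξ) ^ 2) ^ (-(1 / (2 * a j ^ 2)))) ^ (a j ^ 2) := by
          refine lintegral_congr fun ξ => ?_
          rw [charFun_map_sum_mul_pi, ← ofReal_norm, norm_prod,
            ENNReal.ofReal_prod_of_nonneg fun _ _ => norm_nonneg _]
          refine Finset.prod_congr rfl fun j _ => ?_
          have hj := h0 j
          rw [ENNReal.ofReal_rpow_of_nonneg (by positivity) hj.le, norm_charFun_expMeasure_one,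
            ← Real.rpow_mul (by positivity)]
          congr 2
          · ring
          · have : a j ≠ 0 := fun h => by simp [h] at hj
            field_simp
      _ ≤ ∏ j, (∫⁻ ξ : ℝ, ENNReal.ofReal
            ((1 + a j ^ 2 * (-(2 * π) * ξ) ^ 2) ^ (-(1 / (2 * a j ^ 2))))) ^ (a j ^ 2) :=
          ENNReal.lintegral_prod_norm_pow_le _
            (fun j _ => (by fun_prop : Measurable fun ξ : ℝ => ENNReal.ofReal
              ((1 + a j ^ 2 * (-(2 * π) * ξ) ^ 2) ^ (-(1 / (2 * a j ^ 2))))).aemeasurable)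
            ha fun j _ => (h0 j).le
      _ = _ := Finset.prod_congr rfl fun j _ => by rw [lintegral_one_add_mul_sq_rpow (h0 j) (h1 j)]
  have hprod : ∏ j, ENNReal.ofReal (Psi (a j ^ 2) / √2) ^ (a j ^ 2) =
      ENNReal.ofReal ((∏ j, Psi (a j ^ 2) ^ (a j ^ 2)) / √2) := by
    have h2 : √2 = ∏ j, √2 ^ (a j ^ 2) := by
      rw [← Real.rpow_sum_of_pos (by positivity), ha, Real.rpow_one]
    conv_rhs => rw [h2]
    rw [← Finset.prod_div_distrib, ENNReal.ofReal_prod_of_nonneg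
      fun j _ => div_nonneg (Real.rpow_nonneg (hΨ j) _) (by positivity)]
    refine Finset.prod_congr rfl fun j _ => ?_
    rw [ENNReal.ofReal_rpow_of_nonneg (div_nonneg (hΨ j) (by positivity)) (h0 j).le,
      Real.div_rpow (hΨ j) (by positivity)]
  rw [hprod, ENNReal.ofReal_le_ofReal_iff
    (div_nonneg (Finset.prod_nonneg fun j _ => Real.rpow_nonneg (hΨ j) _) (by positivity)),
    le_div_iff₀ (by positivity)] at key
  linarith

/-- **Two-parameter Fourier bound (Case 1.1 of the stability proof).**
For `n ≥ 2` and a unit vector `a ∈ ℝ^{n+1}` with `∑ aⱼ = 0`, all coordinates nonzero and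
`a₁ = maxⱼ |aⱼ|`, setting `m = max_{j>1} |aⱼ|`, we have
`√2 ⬝ p_a(0) ≤ Ψ(a₁²)^{a₁²} Ψ(m²)^{1-a₁²}`. -/
theorem fourier_bound_two_parameters (n : ℕ) (hn : 2 ≤ n)
    (a : EuclideanSpace ℝ (Fin (n + 1))) (hnorm : ‖a‖ = 1)
    (hsum : ∑ j, a j = 0) (hne : ∀ j, a j ≠ 0)
    (hmax : ∀ j, |a j| ≤ a 0)
    (m : ℝ) (hm : IsGreatest ((fun j => |a j|) '' {j : Fin (n + 1) | j ≠ 0}) m)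
    (p : ℝ → ℝ) (hp : IsExpSumDensity (fun j => a j) p) :
    Real.sqrt 2 * p 0 ≤ Psi (a 0 ^ 2) ^ (a 0 ^ 2) * Psi (m ^ 2) ^ (1 - a 0 ^ 2) := by
  have ha : ∑ j, a j ^ 2 = 1 := by
    rw [← EuclideanSpace.real_norm_sq_eq, hnorm, one_pow]
  have h0 : ∀ j, 0 < a j ^ 2 := fun j => sq_pos_of_ne_zero (hne j)
  have h1 : ∀ j, a j ^ 2 < 1 := by
    intro j
    have : Nontrivial (Fin (n + 1)) := Fin.nontrivial_iff_two_le.2 (by omega)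
    obtain ⟨i, hi⟩ := exists_ne j
    rw [← ha]
    exact Finset.single_lt_sum hi (Finset.mem_univ j) (Finset.mem_univ i) (h0 i)
      fun k _ _ => (h0 k).le
  obtain ⟨⟨i, -, hi⟩, hub⟩ := hm
  have hmi : m ^ 2 = a i ^ 2 := by rw [← hi, sq_abs]
  have hle : ∀ j : Fin n, a j.succ ^ 2 ≤ m ^ 2 := fun j => by
    rw [← sq_abs]
    exact pow_le_pow_left₀ (abs_nonneg _) (hub ⟨j.succ, Fin.succ_ne_zero j, rfl⟩) 2
  refine (sqrt_two_mul_density_le_prod_Psi ha h0 h1 hp 0).trans ?_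
  rw [Fin.sum_univ_succ] at ha
  rw [Fin.prod_univ_succ, ← ha, add_sub_cancel_left,
    Real.rpow_sum_of_nonneg (Psi_nonneg (sq_nonneg m)) fun j _ => sq_nonneg _]
  refine mul_le_mul_of_nonneg_left (Finset.prod_le_prod
    (fun j _ => Real.rpow_nonneg (Psi_nonneg (sq_nonneg _)) _) fun j _ => ?_)
    (Real.rpow_nonneg (Psi_nonneg (sq_nonneg _)) _)
  exact Real.rpow_le_rpow (Psi_nonneg (sq_nonneg _))
    (Psi_mono (h0 _) (hle j) (hmi ▸ h1 i)) (sq_nonneg _)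
end
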